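/- arXiv:1610.02640 — 2 statements merged into one kernel-verified Lean document; each statement's English description precedes it below -/
import Mathlib

section
/- For a partition λ with at most n parts and ℓ = λ₁, and T = (T_ℓ,…,T_1) ∈ T^g_λ an admissible tuple in the spinor model, the separated tuple T̄ = (T̄_{2ℓ},…,T̄_1) obtained by the prescribed sequence of jeu-de-taquin moves (F_ℓ^{a_1}⋯F_2^{a_1})⋯(F_{2ℓ−3}^{a_{ℓ−2}} F_{2ℓ−4}^{a_{ℓ−2}}) F_{2ℓ−2}^{a_{ℓ−1}} applied to the 2ℓ-tuple of columns (T_ℓ^L, T_ℓ^R, …, T_1^L, T_1^R) is semistandard: viewed as a filling of the shape η consisting of ν below line L and τ^π above, adjacent columns weakly increase along rows. -/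
/-!
Statement 13: for `T = (T_ℓ,…,T_1) ∈ T^g_λ` an admissible tuple in the spinor model, the
separated tuple `T̄ = (T̄_{2ℓ},…,T̄_1)`, obtained by applying the prescribed sequence of
jeu-de-taquin moves `(𝓕_ℓ^{a_1}⋯𝓕_2^{a_1})⋯(𝓕_{2ℓ−3}^{a_{ℓ−2}}𝓕_{2ℓ−4}^{a_{ℓ−2}})
𝓕_{2ℓ−2}^{a_{ℓ−1}}` to the `2ℓ`-tuple of columns `(T_ℓ^L, T_ℓ^R, …, T_1^L, T_1^R)`, is
defined and semistandard when viewed as a filling of the shape `η` (`ν` below the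
separating line `L`, `τ^π` above): each column strictly increases, the column heights are
`b_i` (for `i ≤ ℓ`) and `b_i + a_{i−ℓ}` (for `i > ℓ`), and adjacent columns, aligned with
the `m`-th column placed with `depth m` boxes below `L`, weakly increase along rows.
-/

namespace KN

/-- The `i`-th entry from the bottom (1-indexed) of a column written top-to-bottom. -/
def getB (l : List ℕ) (i : ℕ) : Option ℕ :=
  if 1 ≤ i ∧ i ≤ l.length then l[l.length - i]? else none

/-- Semistandardness of a two-column skew tableau of shape `λ(a,b,c)` with left column `L`
(of length `c+a`), right column `R` (of length `b+c`), both written top-to-bottom: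
columns strictly increase and, in each of the `c` overlapping rows, the left entry is
no greater than the right entry. -/
def PairSSD (b : ℕ) (L R : List ℕ) : Prop :=
  L.Chain' (· < ·) ∧ R.Chain' (· < ·) ∧
    ∀ i x y, L[i]? = some x → R[b + i]? = some y → x ≤ y

/-- `r_T = 0`: the right column of `T` cannot be slid down one position while keeping
semistandardness (automatic when `a = 0` or `b = 0`). -/
def SlideZero (a b : ℕ) (L R : List ℕ) : Prop :=
  a = 0 ∨ b = 0 ∨ ∃ i x y, L[i]? = some x ∧ R[b + i - 1]? = some y ∧ y < x

/-- State of a two-column skew tableau: `(b, L, R)` where `b` is the shape parameter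
(length of the empty upper part of the left column). -/
abbrev TC := ℕ × List ℕ × List ℕ

def FCond (b : ℕ) (L R : List ℕ) (i : ℕ) : Bool :=
  match L[i]?, R[b - 1 + i]? with
  | _, none => false
  | none, some _ => true
  | some x, some y => decide (y < x)

/-- The jeu de taquin operator `𝓕`: slide into the position above the top of the left
column; the result has shape `λ(a+1, b−1, c)`. -/
def Fop : TC → Option TC := fun t =>
  let b := t.1; let L := t.2.1; let R := t.2.2
  if b = 0 then none else
    match (List.range (L.length + 1)).find? (fun i => FCond b L R i) with
    | none => none
    | some i =>
        match R[b - 1 + i]? with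
        | some y => some (b - 1, L.take i ++ y :: L.drop i, R.eraseIdx (b - 1 + i))
        | none => none

def ECond (b : ℕ) (L R : List ℕ) (i : ℕ) : Bool :=
  match L[i]? with
  | none => false
  | some x =>
      if b + i = 0 then true
      else match R[b + i - 1]? with
        | none => true
        | some y => decide (y < x)

/-- The jeu de taquin operator `𝓔`: slide into the position below the bottom of the right
column; the result has shape `λ(a−1, b+1, c)`. -/
def Eop : TC → Option TC := fun t =>
  let b := t.1; let L := t.2.1; let R := t.2.2
  if L.length + b ≤ R.length then none else
    match ((List.range (R.length - b + 1)).reverse).find? (fun i => ECond b L R i) with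
    | none => none
    | some i =>
        match L[i]? with
        | some x => some (b + 1, L.eraseIdx i, R.insertIdx (b + i) x)
        | none => none

/-- Iteration of a partial operator. -/
def iterO {α : Type} (g : α → Option α) : ℕ → α → Option α
  | 0, t => some t
  | k + 1, t => (g t).bind (iterO g k)

/-- Bounded boolean test of two-column semistandardness (overlap part only). -/
def ssdB (b : ℕ) (U V : List ℕ) : Bool :=
  (List.range U.length).all fun i =>
    match U[i]?, V[b + i]? with
    | some x, some y => decide (x ≤ y)
    | _, _ => true

/-- The canonical offset of a pair of columns `(U, V)` (`U` left, `V` right): the least `b`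
such that the two-column arrangement with offset `b` is semistandard; this realizes `(U,V)`
as the two-column tableau `T` with `(T^L, T^R) = (U, V)` and `r_T = 0`. -/
def pairOffset (U V : List ℕ) : ℕ :=
  match (List.range (V.length + 1)).find? (fun b =>
      decide (V.length ≤ U.length + b) && ssdB b U V) with
  | some b => b
  | none => V.length

/-- `𝓕` on a pair of single columns. -/
def pairF (U V : List ℕ) : Option (List ℕ × List ℕ) :=
  (Fop (pairOffset U V, U, V)).map fun t => (t.2.1, t.2.2)

/-- `𝓔` on a pair of single columns. -/
def pairE (U V : List ℕ) : Option (List ℕ × List ℕ) :=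
  (Eop (pairOffset U V, U, V)).map fun t => (t.2.1, t.2.2)

/-- `𝓕_i` on a tuple of columns (components listed right-to-left, 0-based index `k = i−1`):
apply `𝓕` to the pair formed by components `k+1` (left) and `k` (right). -/
def FiOp (k : ℕ) (us : List (List ℕ)) : Option (List (List ℕ)) :=
  match us[k]?, us[k+1]? with
  | some V, some U => (pairF U V).map fun p => (us.set (k+1) p.1).set k p.2
  | _, _ => none

/-- `𝓔_i` on a tuple of columns. -/
def EiOp (k : ℕ) (us : List (List ℕ)) : Option (List (List ℕ)) :=
  match us[k]?, us[k+1]? with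
  | some V, some U => (pairE U V).map fun p => (us.set (k+1) p.1).set k p.2
  | _, _ => none

end KN
namespace KN

/-- A seminormal pre-crystal structure on a type `α`, with index set `ℕ`
(only finitely many indices are relevant in each use). -/
structure PreCrystal (α : Type) where
  eps : α → ℕ → ℤ
  phi : α → ℕ → ℤ
  e : ℕ → α → Option α
  f : ℕ → α → Option α

variable {α : Type}

/-- `ε_i` of a tensor product `b₁ ⊗ b₂ ⊗ ⋯` (list order = tensor order), computed from
the tensor product rule using `⟨wt b, h_i⟩ = φ_i(b) − ε_i(b)`. -/
def listEps (C : PreCrystal α) (i : ℕ) : List α → ℤ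
  | [] => 0
  | x :: xs => max (C.eps x i) (listEps C i xs - (C.phi x i - C.eps x i))

def listPhi (C : PreCrystal α) (i : ℕ) : List α → ℤ
  | [] => 0
  | x :: xs => max (C.phi x i + (listPhi C i xs - listEps C i xs)) (listPhi C i xs)

/-- `ẽ_i` on a tensor product: `ẽ_i(b₁ ⊗ b₂) = ẽ_i b₁ ⊗ b₂` if `φ_i(b₁) ≥ ε_i(b₂)`,
else `b₁ ⊗ ẽ_i b₂`. -/
def listE (C : PreCrystal α) (i : ℕ) : List α → Option (List α)
  | [] => none
  | x :: xs =>
      if listEps C i xs ≤ C.phi x i then (C.e i x).map (· :: xs)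
      else (listE C i xs).map (x :: ·)

/-- `f̃_i` on a tensor product: `f̃_i(b₁ ⊗ b₂) = f̃_i b₁ ⊗ b₂` if `φ_i(b₁) > ε_i(b₂)`,
else `b₁ ⊗ f̃_i b₂`. -/
def listF (C : PreCrystal α) (i : ℕ) : List α → Option (List α)
  | [] => none
  | x :: xs =>
      if listEps C i xs < C.phi x i then (C.f i x).map (· :: xs)
      else (listF C i xs).map (x :: ·)

/-! The one-box crystal of type `C_n`:
`1 → 2 → ⋯ → n → n̄ → ⋯ → 2̄ → 1̄`, with the letter `k` encoded as `k−1` and `k̄` as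
`2n−k`; the arrow label `i` ranges over `1 ≤ i ≤ n` (1-based). -/

def boxCe (n i v : ℕ) : Option ℕ :=
  if 1 ≤ i ∧ i < n then
    (if v = i then some (i - 1) else if v + i = 2 * n then some (v - 1) else none)
  else if i = n then (if v = n then some (n - 1) else none)
  else none

def boxCf (n i v : ℕ) : Option ℕ :=
  if 1 ≤ i ∧ i < n then
    (if v + 1 = i then some i else if v + 1 + i = 2 * n then some (v + 1) else none)
  else if i = n then (if v + 1 = n then some n else none)
  else none

def boxC (n : ℕ) : PreCrystal ℕ where
  eps v i := if (boxCe n i v).isSome then 1 else 0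
  phi v i := if (boxCf n i v).isSome then 1 else 0
  e i v := boxCe n i v
  f i v := boxCf n i v

/-- The weight in `ℤ^n` of a letter of `𝕁_n^×` (1-based coordinate `k`):
`wt(k) = ε_k`, `wt(k̄) = −ε_k`. -/
def wtBox (n v k : ℕ) : ℤ :=
  if v + 1 = k then 1 else if v + k = 2 * n then -1 else 0

def wtList (n : ℕ) (l : List ℕ) (k : ℕ) : ℤ := (l.map fun v => wtBox n v k).sum

/-- Reconstitute a list of columns from its (modified) reading word. -/
def rebuildJoin (cols : List (List ℕ)) (w : List ℕ) : List (List ℕ) :=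
  (cols.foldl (fun (st : List (List ℕ) × List ℕ) c =>
      (st.1 ++ [st.2.take c.length], st.2.drop c.length)) ([], w)).1

/-- Crystal operator `ẽ_i` on a tableau given as a list of columns (rightmost first, each
top-to-bottom), via the column reading word. -/
def tabE (n i : ℕ) (cols : List (List ℕ)) : Option (List (List ℕ)) :=
  (listE (boxC n) i cols.flatten).map (rebuildJoin cols)

def tabF (n i : ℕ) (cols : List (List ℕ)) : Option (List (List ℕ)) :=
  (listF (boxC n) i cols.flatten).map (rebuildJoin cols)

/-- Does a two-column tableau `(L,R)` (pair of columns over `[n̄]`) carry a domino of two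
`n̄`'s on its top? -/
def dominoTop (n : ℕ) (p : List ℕ × List ℕ) : Bool :=
  (p.1.head? == some n) && (p.2.head? == some n) && decide (p.2.length ≤ p.1.length)

/-- Can a domino of two `n̄`'s be added on top of a two-column tableau `(L,R)`? -/
def canDomino (n : ℕ) (p : List ℕ × List ℕ) : Bool :=
  (match p.1.head? with | some x => decide (n < x) | none => true) &&
  (match p.2.head? with | some x => decide (n < x) | none => true) &&
  decide (p.2.length ≤ p.1.length)

/-- The pre-crystal structure on two-column tableaux `(L,R)` over `[n̄]`: for `i < n`
via the column reading word `R ++ L`; for `i = n` by removing/adding an `n̄n̄`-domino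
on the top. -/
def pairPC (n : ℕ) : PreCrystal (List ℕ × List ℕ) where
  eps p i := if i = n then (if dominoTop n p then 1 else 0)
             else listEps (boxC n) i (p.2 ++ p.1)
  phi p i := if i = n then (if canDomino n p then 1 else 0)
             else listPhi (boxC n) i (p.2 ++ p.1)
  e i p := if i = n then (if dominoTop n p then some (p.1.tail, p.2.tail) else none)
           else (listE (boxC n) i (p.2 ++ p.1)).map
              (fun w => (w.drop p.2.length, w.take p.2.length))
  f i p := if i = n then (if canDomino n p then some (n :: p.1, n :: p.2) else none)
           else (listF (boxC n) i (p.2 ++ p.1)).map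
              (fun w => (w.drop p.2.length, w.take p.2.length))

end KN
namespace KN

/-- The tableau `~(^R T)`: the increasing column with entries the letters `k ∈ [n]`
(code `k−1`) such that `k̄` (code `2n−k`) does not occur in `^R T`. -/
def compBar (n : ℕ) (RT : List ℕ) : List ℕ :=
  (List.range n).filter fun j => ! RT.contains (2 * n - 1 - j)

/-- The map `T ↦ T̃` on `T^{c_n}(a)` (shape `λ(a,0,c)`). -/
def tildeMap (n a : ℕ) (p : List ℕ × List ℕ) : List ℕ :=
  match iterO Eop a (0, p.1, p.2) with
  | some t => compBar n t.2.2 ++ t.2.1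
  | none => []

/-- The Kashiwara–Nakashima one-column condition of type `C_n` for a column of height
`h`. -/
def KN1 (n h : ℕ) (l : List ℕ) : Prop :=
  ∀ c i₁ i₂, 1 ≤ c → c ≤ n →
    getB l i₁ = some (2 * n - c) → getB l i₂ = some (c - 1) → i₁ < i₂ →
      i₁ + h + 1 ≤ c + i₂

/-- The set `T^{c_n}(a)`, encoded as pairs of columns `(L, R)` over
`[n̄] = {n,…,2n−1}` forming a semistandard tableau of shape `λ(a,0,c)`. -/
def TCnSet (n a : ℕ) : Set (List ℕ × List ℕ) :=
  {p | p.1.length = p.2.length + a ∧ PairSSD 0 p.1 p.2 ∧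
      (∀ x ∈ p.1, n ≤ x ∧ x < 2 * n) ∧ ∀ x ∈ p.2, n ≤ x ∧ x < 2 * n}

/-- The set `KN^{c_n}_{(1^h)}` of KN columns of type `C_n` of height `h`, over
`𝕁_n^× = {1 < ⋯ < n < n̄ < ⋯ < 1̄}` encoded as `{0,…,2n−1}`. -/
def KNcolC (n h : ℕ) : Set (List ℕ) :=
  {l | l.length = h ∧ l.Chain' (· < ·) ∧ (∀ x ∈ l, x < 2 * n) ∧ KN1 n h l}

/-- The inverse map `Ψ_a`: split a KN column `T` into its barred part `T₋` and the barred
complement `~T₊` of its unbarred part, and apply `𝓕^{n−a}`. -/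
def PsiCol (n : ℕ) (T : List ℕ) : List ℕ × List ℕ :=
  let U := T.filter fun x => decide (n ≤ x)
  let V := (List.range n).filterMap fun j =>
    let k := n - j
    if T.contains (k - 1) then none else some (2 * n - k)
  match iterO Fop (n - T.length) (pairOffset U V, U, V) with
  | some t => (t.2.1, t.2.2)
  | none => ([], [])

end KN
namespace KN

/-- Entry `T(i,j)` of a KN tableau: the `i`-th row from the bottom of the `j`-th column
from the right (both 1-based); the tableau is a list of columns, rightmost first. -/
def entKN (cols : List (List ℕ)) (i j : ℕ) : Option ℕ := getB (cols.getD (j - 1) []) i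

/-- The Kashiwara–Nakashima two-column condition (`c`-2) of type `C_n`. -/
def KN2 (n : ℕ) (cols : List (List ℕ)) : Prop :=
  ∀ j a b p q r s, 1 ≤ a → a ≤ b → b ≤ n → p ≤ q → q < r → r ≤ s →
    ((entKN cols p j = some (2 * n - a) ∧ entKN cols q j = some (2 * n - b) ∧
      entKN cols r j = some (b - 1) ∧ entKN cols s (j + 1) = some (a - 1)) ∨
     (entKN cols p j = some (2 * n - a) ∧ entKN cols q (j + 1) = some (2 * n - b) ∧
      entKN cols r (j + 1) = some (b - 1) ∧ entKN cols s (j + 1) = some (a - 1))) →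
    (q - p) + (s - r) < b - a

/-- The set `KN^{c_n}_λ` of KN tableaux of type `C_n` of shape `λ`, where `hs` is the list
of column heights `λ'_1 ≥ λ'_2 ≥ ⋯` from the right; a tableau is the list of its columns,
rightmost first, bottom-aligned (shape `λ^π`). -/
def KNtabC (n : ℕ) (hs : List ℕ) : Set (List (List ℕ)) :=
  {cols | cols.length = hs.length ∧
    (∀ j, (cols.getD j []).length = hs.getD j 0) ∧
    (∀ col ∈ cols, col.Chain' (· < ·) ∧ ∀ x ∈ col, x < 2 * n) ∧
    (∀ j ρ x y, getB (cols.getD (j+1) []) ρ = some x → getB (cols.getD j []) ρ = some y →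
      x ≤ y) ∧
    (∀ col ∈ cols, KN1 n col.length col) ∧ KN2 n cols}

/-- The tail height `a` of a two-column tableau `(L,R)` with its canonical offset. -/
def aOf (p : List ℕ × List ℕ) : ℕ := p.1.length - (p.2.length - pairOffset p.1 p.2)

/-- The straightened left column `^L T` of `T ∈ T^g(a)` (type `C`: offset `0`). -/
def sepL (p : List ℕ × List ℕ) : List ℕ :=
  match iterO Eop (aOf p) (pairOffset p.1 p.2, p.1, p.2) with
  | some t => t.2.1
  | none => []

/-- The straightened right column `^R T`. -/
def sepR (p : List ℕ × List ℕ) : List ℕ :=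
  match iterO Eop (aOf p) (pairOffset p.1 p.2, p.1, p.2) with
  | some t => t.2.2
  | none => []

/-- Admissibility `T₂ ≺ T₁` of a pair of two-column tableaux (Definition 3.5 (1)):
(i) `ht(T₂^R) ≤ ht(T₁^L) − a₁`, (ii) `T₂^R(i) ≤ ^L T₁(i)`,
(iii) `^R T₂(i + a₂ − a₁) ≤ T₁^L(i)` (entries counted from the bottom). -/
def Adm (p₂ p₁ : List ℕ × List ℕ) : Prop :=
  p₂.2.length + aOf p₁ ≤ p₁.1.length ∧
  (∀ i x y, getB p₂.2 i = some x → getB (sepL p₁) i = some y → x ≤ y) ∧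
  (∀ i x y, getB (sepR p₂) (i + (aOf p₂ - aOf p₁)) = some x → getB p₁.1 i = some y →
    x ≤ y)

/-- The spinor model `T^{c_n}_λ`: tuples `(T_ℓ, …, T_1)` with `T_i ∈ T^{c_n}(n − λ'_i)`
and `T_{i+1} ≺ T_i`, listed in tensor order `[T_1, T_2, …]`. -/
def SpinModelC (n : ℕ) (hs : List ℕ) : Set (List (List ℕ × List ℕ)) :=
  {ts | ts.length = hs.length ∧
    (∀ j, j < ts.length → ts.getD j ([], []) ∈ TCnSet n (n - hs.getD j 0)) ∧
    ∀ j, j + 1 < ts.length → Adm (ts.getD (j+1) ([], [])) (ts.getD j ([], []))}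

/-- The column-wise map `Ψ_λ`. -/
def PsiTab (n : ℕ) (cols : List (List ℕ)) : List (List ℕ × List ℕ) :=
  cols.map (PsiCol n)

end KN
namespace KN

/-- Generic element of `T^g(a)` (types `B` and `C`): a two-column semistandard tableau
over `[n̄]` with `r_T = 0`, encoded by its pair of columns (the offset `b` is recovered as
the canonical offset). -/
def TGSet (n a : ℕ) : Set (List ℕ × List ℕ) :=
  {p | p.2.length ≤ p.1.length + pairOffset p.1 p.2 ∧
      PairSSD (pairOffset p.1 p.2) p.1 p.2 ∧ aOf p = a ∧
      (∀ x ∈ p.1, n ≤ x ∧ x < 2 * n) ∧ ∀ x ∈ p.2, n ≤ x ∧ x < 2 * n}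

/-- The `2ℓ`-tuple of columns `(T_ℓ^L, T_ℓ^R, …, T_1^L, T_1^R)` of a tuple of two-column
tableaux, listed right-to-left (component `2i−1` is `T_i^R`, component `2i` is `T_i^L`). -/
def colsOf (ts : List (List ℕ × List ℕ)) : List (List ℕ) :=
  ts.flatMap fun p => [p.2, p.1]

/-- The separation
`T̄ = (𝓕_ℓ^{a_1} ⋯ 𝓕_2^{a_1}) ⋯ (𝓕_{2ℓ−3}^{a_{ℓ−2}} 𝓕_{2ℓ−4}^{a_{ℓ−2}}) 𝓕_{2ℓ−2}^{a_{ℓ−1}} T`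
(operators applied right-to-left; `𝓕_k` with 1-based index `k` is `FiOp (k−1)`). -/
def separate (ℓ : ℕ) (aseq : ℕ → ℕ) (us : List (List ℕ)) : Option (List (List ℕ)) :=
  (List.range (ℓ - 1)).foldlM
    (fun cur j' =>
      let j := ℓ - 1 - j'
      (List.range' (2 * j) (ℓ - j)).foldlM
        (fun cur2 k => iterO (FiOp (k - 1)) (aseq j) cur2) cur)
    us

/-- The tail heights `a_j` (`1 ≤ j ≤ ℓ`) of a tuple `(T_ℓ,…,T_1)` listed in tensor order
`[T_1, T_2, …]`. -/
def aseqOf (ts : List (List ℕ × List ℕ)) (j : ℕ) : ℕ := aOf (ts.getD (j - 1) ([], []))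

/-- The body heights `b_1, …, b_{2ℓ}` (`b_{2i−1} = ht(T_i^R)`,
`b_{2i} = ht(T_i^L) − a_i`), as a function of the 0-based component index. -/
def bseqOf (ts : List (List ℕ × List ℕ)) (m : ℕ) : ℕ :=
  if m % 2 = 0 then (ts.getD (m / 2) ([], [])).2.length
  else (ts.getD (m / 2) ([], [])).1.length - aOf (ts.getD (m / 2) ([], []))

/-- Depth below the separating horizontal line `L` of the `m`-th column (0-based) of the
separated tuple: `0` for the `ℓ` rightmost columns, `a_{m−ℓ+1}` for the others. -/
def depth (ℓ : ℕ) (aseq : ℕ → ℕ) (m : ℕ) : ℕ := if m < ℓ then 0 else aseq (m - ℓ + 1)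

end KN


namespace KN

/-- number of entries `≥ v` -/
def cnt (l : List ℕ) (v : ℕ) : ℤ := ((l.countP (fun x => decide (v ≤ x)) : ℕ) : ℤ)

/-- strictly increasing column -/
def Str (l : List ℕ) : Prop := l.Pairwise (· < ·)

theorem cnt_nonneg (l : List ℕ) (v : ℕ) : 0 ≤ cnt l v := by simp [cnt]

theorem cnt_le_length (l : List ℕ) (v : ℕ) : cnt l v ≤ l.length := by
  unfold cnt; exact_mod_cast List.countP_le_length

theorem cnt_zero (l : List ℕ) : cnt l 0 = l.length := by
  simp [cnt]

theorem cnt_anti (l : List ℕ) {v w : ℕ} (h : v ≤ w) : cnt l w ≤ cnt l v := by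
  unfold cnt
  have : l.countP (fun x => decide (w ≤ x)) ≤ l.countP (fun x => decide (v ≤ x)) := by
    apply List.countP_mono_left
    intro x _ hx
    simp at hx ⊢
    omega
  exact_mod_cast this

theorem cnt_append (l m : List ℕ) (v : ℕ) : cnt (l ++ m) v = cnt l v + cnt m v := by
  simp [cnt]

theorem cnt_cons (y : ℕ) (m : List ℕ) (v : ℕ) :
    cnt (y :: m) v = cnt m v + if v ≤ y then 1 else 0 := by
  by_cases h : v ≤ y <;> simp [cnt, h]

theorem cnt_split (l : List ℕ) (v j : ℕ) (hj : j ≤ l.length)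
    (h1 : ∀ i x, i < j → l[i]? = some x → x < v)
    (h2 : ∀ i x, j ≤ i → l[i]? = some x → v ≤ x) : cnt l v + j = l.length := by
  have e1 : cnt (l.take j) v = 0 := by
    unfold cnt
    norm_cast
    rw [List.countP_eq_zero]
    intro x hx
    obtain ⟨i, hi⟩ := List.mem_iff_getElem?.1 hx
    rw [List.getElem?_take] at hi
    split_ifs at hi with hij
    have := h1 i x hij hi
    simp; omega
  have e2 : cnt (l.drop j) v = (l.drop j).length := by
    unfold cnt
    norm_cast
    rw [List.countP_eq_length]
    intro x hx
    obtain ⟨i, hi⟩ := List.mem_iff_getElem?.1 hx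
    rw [List.getElem?_drop] at hi
    have := h2 (j + i) x (by omega) hi
    simpa using this
  have e3 := cnt_append (l.take j) (l.drop j) v
  rw [List.take_append_drop, e1, e2, List.length_drop] at e3
  omega

theorem Str.lt {l : List ℕ} (h : Str l) {i j x y : ℕ} (hij : i < j)
    (hx : l[i]? = some x) (hy : l[j]? = some y) : x < y := by
  obtain ⟨hi, rfl⟩ := List.getElem?_eq_some_iff.1 hx
  obtain ⟨hj, rfl⟩ := List.getElem?_eq_some_iff.1 hy
  exact List.pairwise_iff_getElem.1 h i j hi hj hij

theorem Str.le {l : List ℕ} (h : Str l) {i j x y : ℕ} (hij : i ≤ j)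
    (hx : l[i]? = some x) (hy : l[j]? = some y) : x ≤ y := by
  rcases hij.lt_or_eq with h' | rfl
  · exact (h.lt h' hx hy).le
  · rw [hx] at hy; simp at hy; omega

theorem Str.split {l : List ℕ} (h : Str l) (v : ℕ) : ∃ j ≤ l.length,
    (∀ i x, i < j → l[i]? = some x → x < v) ∧
    (∀ i x, j ≤ i → l[i]? = some x → v ≤ x) ∧ cnt l v + j = l.length := by
  suffices H : ∃ j ≤ l.length,
    (∀ i x, i < j → l[i]? = some x → x < v) ∧
    (∀ i x, j ≤ i → l[i]? = some x → v ≤ x) by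
    obtain ⟨j, a, b, c⟩ := H
    exact ⟨j, a, b, c, cnt_split l v j a b c⟩
  have hex : ∃ j, l.length ≤ j ∨ ∃ x, l[j]? = some x ∧ v ≤ x := ⟨l.length, Or.inl le_rfl⟩
  classical
  refine ⟨Nat.find hex, Nat.find_le (Or.inl le_rfl), ?_, ?_⟩
  · intro i x hi hx
    have := Nat.find_min hex hi
    push Not at this
    exact this.2 x hx
  · intro i x hi hx
    rcases Nat.find_spec hex with h' | ⟨y, hy, hvy⟩
    · have := (List.getElem?_eq_some_iff.1 hx).1
      omega
    · exact hvy.trans (h.le hi hy hx)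

theorem Str.cnt_get {l : List ℕ} (h : Str l) {i x : ℕ} (hx : l[i]? = some x) :
    cnt l x + i = l.length :=
  cnt_split l x i (List.getElem?_eq_some_iff.1 hx).1.le
    (fun _ _ hj hy => h.lt hj hy hx) (fun _ _ hj hy => h.le hj hx hy)

theorem Str.cnt_get_succ {l : List ℕ} (h : Str l) {i x : ℕ} (hx : l[i]? = some x) :
    cnt l (x + 1) + i + 1 = l.length := by
  have := cnt_split l (x + 1) (i + 1) (List.getElem?_eq_some_iff.1 hx).1
    (fun j y hj hy => by have := h.le (show j ≤ i by omega) hy hx; omega)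
    (fun j y hj hy => by have := h.lt (show i < j by omega) hx hy; omega)
  push_cast at this
  omega

theorem Str.insert {l : List ℕ} (h : Str l) (k y : ℕ)
    (h1 : ∀ i x, i < k → l[i]? = some x → x < y)
    (h2 : ∀ i x, k ≤ i → l[i]? = some x → y < x) :
    Str (l.take k ++ y :: l.drop k) ∧
    ∀ v, cnt (l.take k ++ y :: l.drop k) v = cnt l v + if v ≤ y then 1 else 0 := by
  constructor
  · unfold Str at *
    have h3 : ∀ x ∈ l.take k, x < y := by
      intro x hx
      obtain ⟨i, hi⟩ := List.mem_iff_getElem?.1 hx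
      rw [List.getElem?_take] at hi
      split_ifs at hi with hij
      exact h1 i x hij hi
    have h4 : ∀ x ∈ l.drop k, y < x := by
      intro x hx
      obtain ⟨i, hi⟩ := List.mem_iff_getElem?.1 hx
      rw [List.getElem?_drop] at hi
      exact h2 _ x (by omega) hi
    rw [List.pairwise_append]
    refine ⟨h.sublist (List.take_sublist _ _), ?_, ?_⟩
    · rw [List.pairwise_cons]
      exact ⟨h4, h.sublist (List.drop_sublist _ _)⟩
    · intro a ha b hb
      rcases List.mem_cons.1 hb with rfl | hb
      · exact h3 a ha
      · exact (h3 a ha).trans (h4 b hb)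
  · intro v
    rw [cnt_append, cnt_cons]
    have e3 := cnt_append (l.take k) (l.drop k) v
    rw [List.take_append_drop] at e3
    omega

theorem Str.erase {l : List ℕ} (h : Str l) {k y : ℕ} (hy : l[k]? = some y) :
    Str (l.eraseIdx k) ∧
    ∀ v, cnt l v = cnt (l.eraseIdx k) v + if v ≤ y then 1 else 0 := by
  refine ⟨h.sublist (List.eraseIdx_sublist _ _), fun v => ?_⟩
  obtain ⟨hk, rfl⟩ := List.getElem?_eq_some_iff.1 hy
  have e3 := cnt_append (l.take k) (l.drop k) v
  rw [List.take_append_drop, List.drop_eq_getElem_cons hk, cnt_cons] at e3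
  rw [List.eraseIdx_eq_take_drop_succ, cnt_append]
  omega

/-- `e` is the exact maximum of `cnt U - cnt V` -/
def Mx (U V : List ℕ) (e : ℤ) : Prop :=
  (∀ v, cnt U v - cnt V v ≤ e) ∧ ∃ v, cnt U v - cnt V v = e

theorem cnt_large (l : List ℕ) : ∃ N, ∀ v, N ≤ v → cnt l v = 0 := by
  induction l with
  | nil => exact ⟨0, by simp [cnt]⟩
  | cons a l ih =>
    obtain ⟨N, hN⟩ := ih
    refine ⟨max N (a + 1), fun v hv => ?_⟩
    rw [cnt_cons, hN v (by omega), if_neg (by omega)]; rfl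

theorem exists_zero (U V : List ℕ) : ∃ v, cnt U v = 0 ∧ cnt V v = 0 := by
  obtain ⟨N, hN⟩ := cnt_large U
  obtain ⟨M, hM⟩ := cnt_large V
  exact ⟨max N M, hN _ (by omega), hM _ (by omega)⟩

theorem Mx.nonneg {U V : List ℕ} {e : ℤ} (h : Mx U V e) : 0 ≤ e := by
  obtain ⟨v, h1, h2⟩ := exists_zero U V
  have := h.1 v
  omega

theorem ssd_iff {U V : List ℕ} (hU : Str U) (hV : Str V) (b : ℕ)
    (hb : V.length ≤ U.length + b) :
    (∀ i x y, U[i]? = some x → V[b + i]? = some y → x ≤ y) ↔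
      ∀ v, cnt U v - cnt V v ≤ U.length + b - V.length := by
  constructor
  · intro h v
    obtain ⟨i, hi, hi1, hi2, hi3⟩ := hU.split v
    obtain ⟨j, hj, hj1, hj2, hj3⟩ := hV.split v
    by_contra hc
    have hlt : i + b < j := by omega
    have hil : i < U.length := by omega
    have g1 : U[i]? = some U[i] := List.getElem?_eq_getElem hil
    have g2 : V[b + i]? = some V[b + i] := List.getElem?_eq_getElem (by omega)
    have := h i _ _ g1 g2
    have := hi2 i _ le_rfl g1
    have := hj1 (b + i) _ (by omega) g2
    omega
  · intro h i x y hx hy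
    have := h x
    have h1 := hU.cnt_get hx
    obtain ⟨j, hj, hj1, hj2, hj3⟩ := hV.split x
    exact hj2 (b + i) y (by omega) hy

theorem ssdB_iff (b : ℕ) (U V : List ℕ) : ssdB b U V = true ↔
    (∀ i x y, U[i]? = some x → V[b + i]? = some y → x ≤ y) := by
  unfold ssdB
  rw [List.all_eq_true]
  constructor
  · intro h i x y hx hy
    have := h i (List.mem_range.2 (List.getElem?_eq_some_iff.1 hx).1)
    rw [hx, hy] at this
    simpa using this
  · intro h i _
    cases hx : U[i]? with
    | none => simp
    | some x =>
      cases hy : V[b + i]? with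
      | none => simp
      | some y => simpa using h i x y hx hy

theorem find_fwd (p : ℕ → Bool) (n : ℕ) (h : ∃ i < n, p i = true) :
    ∃ i < n, p i = true ∧ (∀ j < i, p j = false) ∧ (List.range n).find? p = some i := by
  classical
  have hex : ∃ i, i < n ∧ p i = true := h
  have h1 := Nat.find_spec hex
  have h3 : ∀ j < Nat.find hex, p j = false := by
    intro j hj
    have := Nat.find_min hex hj
    by_contra hc
    exact this ⟨by omega, by simpa using hc⟩
  refine ⟨Nat.find hex, h1.1, h1.2, h3, ?_⟩
  rw [List.find?_range_eq_some]
  refine ⟨h1.2, List.mem_range.2 h1.1, ?_⟩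
  intro j hj
  simp [h3 j hj]

theorem find_rev (p : ℕ → Bool) (n : ℕ) (h : ∃ i < n, p i = true) :
    ∃ i < n, p i = true ∧ (∀ j, i < j → j < n → p j = false) ∧
      (List.range n).reverse.find? p = some i := by
  induction n with
  | zero => obtain ⟨i, hi, _⟩ := h; omega
  | succ n ih =>
    by_cases hp : p n = true
    · exact ⟨n, by omega, hp, fun j _ _ => by omega, by simp [List.range_succ, hp]⟩
    · obtain ⟨i, hi, hpi⟩ := h
      have : i ≠ n := by rintro rfl; exact hp hpi
      obtain ⟨k, hk, hpk, hk2, hk3⟩ := ih ⟨i, by omega, hpi⟩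
      refine ⟨k, by omega, hpk, fun j h1 h2 => ?_, ?_⟩
      · by_cases hj : j = n
        · subst hj; simpa using hp
        · exact hk2 j h1 (by omega)
      · rw [List.range_succ, List.reverse_append]
        simpa [hp] using hk3

theorem offset_Mx {U V : List ℕ} (hU : Str U) (hV : Str V) :
    Mx U V (U.length + pairOffset U V - V.length) := by
  obtain ⟨b, hb, hp, hmin, hfind⟩ := find_fwd
    (fun b => decide (V.length ≤ U.length + b) && ssdB b U V) (V.length + 1)
    ⟨V.length, by omega, by
      simp only [Bool.and_eq_true, decide_eq_true_eq, ssdB_iff]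
      refine ⟨by omega, fun i x y _ hy => ?_⟩
      have := (List.getElem?_eq_some_iff.1 hy).1
      omega⟩
  have hoff : pairOffset U V = b := by
    unfold pairOffset
    rw [hfind]
  rw [hoff]
  simp only [Bool.and_eq_true, decide_eq_true_eq, ssdB_iff] at hp
  have hle := (ssd_iff hU hV b hp.1).1 hp.2
  refine ⟨hle, ?_⟩
  by_cases he : V.length = U.length + b
  · obtain ⟨v, h1, h2⟩ := exists_zero U V
    exact ⟨v, by omega⟩
  by_cases hb0 : b = 0
  · refine ⟨0, ?_⟩
    rw [cnt_zero, cnt_zero]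
    omega
  have h1 := hmin (b - 1) (by omega)
  by_contra hc
  push Not at hc
  have h2 : ssdB (b - 1) U V = true := by
    rw [ssdB_iff, ssd_iff hU hV (b - 1) (by omega)]
    intro v
    have := hle v
    have := hc v
    omega
  simp [h2] at h1
  omega

theorem Mx.unique {U V : List ℕ} {e e' : ℤ} (h : Mx U V e) (h' : Mx U V e') : e = e' := by
  obtain ⟨h1, v, hv⟩ := h
  obtain ⟨h2, w, hw⟩ := h'
  have := h1 w
  have := h2 v
  omega

theorem Fop_spec {U V : List ℕ} (hU : Str U) (hV : Str V) {e : ℤ} (h : Mx U V e) (b : ℕ)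
    (hb : (b : ℤ) + U.length = e + V.length) (hpos : 0 < b) :
    ∃ y U' V', Fop (b, U, V) = some (b - 1, U', V') ∧ Str U' ∧ Str V' ∧
      (∀ v, cnt U' v = cnt U v + if v ≤ y then 1 else 0) ∧
      (∀ v, cnt V v = cnt V' v + if v ≤ y then 1 else 0) ∧
      cnt U (y + 1) - cnt V (y + 1) = e ∧ cnt U y - cnt V y = e - 1 ∧
      ∀ v ≤ y, cnt U v - cnt V v < e := by
  have hfc : ∀ i, FCond b U V i = true ↔ ∃ y, V[b - 1 + i]? = some y ∧
      ∀ x, U[i]? = some x → y < x := by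
    intro i
    unfold FCond
    cases hx : U[i]? with
    | none => cases hy : V[b - 1 + i]? <;> simp
    | some x => cases hy : V[b - 1 + i]? <;> simp
  obtain ⟨i, hi, hp, hmin, hfind⟩ := find_fwd (fun i => FCond b U V i) (U.length + 1) (by
    obtain ⟨_, v, hv⟩ := h
    obtain ⟨i, hi, hi1, hi2, hi3⟩ := hU.split v
    obtain ⟨j, hj, hj1, hj2, hj3⟩ := hV.split v
    have hji : j = i + b := by omega
    refine ⟨i, by omega, ?_⟩
    rw [hfc]
    have g2 : V[b - 1 + i]? = some V[b - 1 + i] := List.getElem?_eq_getElem (by omega)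
    refine ⟨_, g2, fun x hx => ?_⟩
    have := hi2 i x le_rfl hx
    have := hj1 _ _ (by omega) g2
    omega)
  have hp0 := (hfc i).1 hp
  obtain ⟨y, hy, hyx⟩ := hp0
  have hbelow : ∀ k x, k < i → U[k]? = some x → x < y := by
    intro k x hk hx
    have h1 : ¬ FCond b U V k = true := by simpa using hmin k hk
    rw [hfc] at h1
    push Not at h1
    have hl := (List.getElem?_eq_some_iff.1 hy).1
    have g2 : V[b - 1 + k]? = some V[b - 1 + k] := List.getElem?_eq_getElem (by omega)
    obtain ⟨x', hx', hle⟩ := h1 _ g2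
    rw [hx] at hx'
    simp at hx'
    have := hV.lt (show b - 1 + k < b - 1 + i by omega) g2 hy
    omega
  have habove : ∀ k x, i ≤ k → U[k]? = some x → y < x := by
    intro k x hk hx
    have hl := (List.getElem?_eq_some_iff.1 hx).1
    have g1 : U[i]? = some U[i] := List.getElem?_eq_getElem (by omega)
    have := hyx _ g1
    have := hU.le hk g1 hx
    omega
  obtain ⟨hs1, hc1⟩ := hU.insert i y hbelow habove
  obtain ⟨hs2, hc2⟩ := hV.erase hy
  refine ⟨y, _, _, ?_, hs1, hs2, hc1, hc2, ?_, ?_, ?_⟩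
  · simp only [Fop]
    rw [if_neg (by omega), hfind]
    simp only [hy]
  · have h1 := hV.cnt_get_succ hy
    have h2 := cnt_split U (y + 1) i (by omega)
      (fun k x hk hx => by have := hbelow k x hk hx; omega)
      (fun k x hk hx => by have := habove k x hk hx; omega)
    push_cast at h1 h2
    omega
  · have h1 := hV.cnt_get hy
    have h2 := cnt_split U y i (by omega) hbelow
      (fun k x hk hx => by have := habove k x hk hx; omega)
    push_cast at h1 h2
    omega
  · intro v hv
    obtain ⟨i1, hi0, hi1, hi2, hi3⟩ := hU.split v
    obtain ⟨j, hj, hj1, hj2, hj3⟩ := hV.split v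
    have hle : i1 ≤ i := by
      by_contra hc
      have g1 : U[i]? = some U[i] := List.getElem?_eq_getElem (by omega)
      have := hi1 i _ (by omega) g1
      have := hyx _ g1
      omega
    have hl := (List.getElem?_eq_some_iff.1 hy).1
    by_contra hc
    have hj' : b - 1 + i1 < j := by omega
    have g2 : V[b - 1 + i1]? = some V[b - 1 + i1] := List.getElem?_eq_getElem (by omega)
    have h5 := hj1 _ _ hj' g2
    rcases hle.lt_or_eq with hlt | rfl
    · have h1 : ¬ FCond b U V i1 = true := by simpa using hmin i1 hlt
      rw [hfc] at h1
      push Not at h1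
      obtain ⟨x', hx', hle⟩ := h1 _ g2
      have := hi2 _ _ le_rfl hx'
      omega
    · rw [hy] at g2
      simp at g2
      omega

theorem insertIdx_eq_app (l : List ℕ) (k x : ℕ) (h : k ≤ l.length) :
    l.insertIdx k x = l.take k ++ x :: l.drop k := by
  induction l generalizing k with
  | nil =>
    have : k = 0 := by simpa using h
    subst this; simp
  | cons a l ih =>
    cases k with
    | zero => simp
    | succ k => simp [List.insertIdx_succ_cons, ih k (by simpa using h)]

theorem Eop_spec {L R : List ℕ} (hL : Str L) (hR : Str R) {e : ℤ} (h : Mx L R e) (b : ℕ)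
    (hb : (b : ℤ) + L.length = e + R.length) (hpos : 0 < e) :
    ∃ x L' R', Eop (b, L, R) = some (b + 1, L', R') ∧ Str L' ∧ Str R' ∧
      (∀ v, cnt L v = cnt L' v + if v ≤ x then 1 else 0) ∧
      (∀ v, cnt R' v = cnt R v + if v ≤ x then 1 else 0) ∧
      cnt L (x + 1) - cnt R (x + 1) = e - 1 ∧
      ∀ v, x < v → cnt L v - cnt R v < e := by
  have hbR : b ≤ R.length := by
    obtain ⟨_, v, hv⟩ := h
    have := cnt_le_length L v
    have := cnt_nonneg R v
    omega
  have hec : ∀ i, ECond b L R i = true ↔ ∃ x, L[i]? = some x ∧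
      (b + i ≠ 0 → ∀ y, R[b + i - 1]? = some y → y < x) := by
    intro i
    unfold ECond
    cases hx : L[i]? with
    | none => simp
    | some x =>
      by_cases h0 : b + i = 0
      · simp [h0]
      · simp only [if_neg h0]
        cases hy : R[b + i - 1]? <;> simp <;> omega
  obtain ⟨i, hi, hp, hmax, hfind⟩ := find_rev (fun i => ECond b L R i) (R.length - b + 1) (by
    obtain ⟨_, v, hv⟩ := h
    obtain ⟨i, hi, hi1, hi2, hi3⟩ := hL.split v
    obtain ⟨j, hj, hj1, hj2, hj3⟩ := hR.split v
    have hji : j = i + b := by omega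
    refine ⟨i, by omega, ?_⟩
    rw [hec]
    have g2 : L[i]? = some L[i] := List.getElem?_eq_getElem (by omega)
    refine ⟨_, g2, fun h0 y hy => ?_⟩
    have := hi2 i _ le_rfl g2
    have := hj1 _ _ (by omega) hy
    omega)
  obtain ⟨x, hx, hyx⟩ := (hec i).1 hp
  have hbelow : ∀ k y, k < b + i → R[k]? = some y → y < x := by
    intro k y hk hy
    have g2 : R[b + i - 1]? = some R[b + i - 1] := List.getElem?_eq_getElem (by omega)
    have := hyx (by omega) _ g2
    have := hR.le (show k ≤ b + i - 1 by omega) hy g2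
    omega
  have hnext : ∀ k z, i < k → k ≤ R.length - b → L[k]? = some z →
      ∃ y, R[b + k - 1]? = some y ∧ z ≤ y := by
    intro k z hk hk2 hz
    have h1 : ¬ ECond b L R k = true := by simpa using hmax k hk (by omega)
    rw [hec] at h1
    push Not at h1
    obtain ⟨_, y, hy, hle⟩ := h1 _ hz
    exact ⟨y, hy, hle⟩
  have habove : ∀ k y, b + i ≤ k → R[k]? = some y → x < y := by
    intro k y hk hy
    have hl := (List.getElem?_eq_some_iff.1 hy).1
    have g1 : L[i + 1]? = some L[i + 1] := List.getElem?_eq_getElem (by omega)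
    obtain ⟨y', hy', hle⟩ := hnext (i + 1) _ (by omega) (by omega) g1
    have := hL.lt (show i < i + 1 by omega) hx g1
    have := hR.le (show b + (i + 1) - 1 ≤ k by omega) hy' hy
    omega
  obtain ⟨hs1, hc1⟩ := hR.insert (b + i) x hbelow habove
  obtain ⟨hs2, hc2⟩ := hL.erase hx
  refine ⟨x, _, _, ?_, hs2, hs1, hc2, hc1, ?_, ?_⟩
  · simp only [Eop]
    rw [if_neg (by omega), hfind]
    simp only [hx]
    rw [insertIdx_eq_app _ _ _ (by omega)]
  · have h1 := hL.cnt_get_succ hx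
    have h2 := cnt_split R (x + 1) (b + i) (by omega)
      (fun k x hk hx => by have := hbelow k x hk hx; omega)
      (fun k x hk hx => by have := habove k x hk hx; omega)
    push_cast at h1 h2
    omega
  · intro v hv
    obtain ⟨i1, hi0, hi1, hi2, hi3⟩ := hL.split v
    obtain ⟨j, hj, hj1, hj2, hj3⟩ := hR.split v
    have hle : i < i1 := by
      by_contra hc
      have := hi2 i _ (by omega) hx
      omega
    by_contra hc
    have hj' : b + i1 ≤ j := by omega
    have g1 : L[i1]? = some L[i1] := List.getElem?_eq_getElem (by omega)
    obtain ⟨y', hy', hle'⟩ := hnext i1 _ hle (by omega) g1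
    have := hi2 _ _ le_rfl g1
    have := hj1 _ _ (by omega) hy'
    omega

end KN

namespace KN

theorem pairF_spec {U V : List ℕ} (hU : Str U) (hV : Str V) {e : ℤ} (h : Mx U V e)
    (hpos : 0 < e + V.length - U.length) :
    ∃ y U' V', pairF U V = some (U', V') ∧ Str U' ∧ Str V' ∧
      (∀ v, cnt U' v = cnt U v + if v ≤ y then 1 else 0) ∧
      (∀ v, cnt V v = cnt V' v + if v ≤ y then 1 else 0) ∧
      cnt U (y + 1) - cnt V (y + 1) = e ∧ cnt U y - cnt V y = e - 1 ∧
      ∀ v ≤ y, cnt U v - cnt V v < e := by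
  have h1 := (offset_Mx hU hV).unique h
  obtain ⟨y, U', V', hf, hrest⟩ := Fop_spec hU hV h (pairOffset U V) (by omega) (by omega)
  refine ⟨y, U', V', ?_, hrest⟩
  unfold pairF
  rw [hf]
  rfl

theorem FiOp_spec (k : ℕ) (us : List (List ℕ)) (hk : k + 1 < us.length) (U' V' : List ℕ)
    (h : pairF (us.getD (k + 1) []) (us.getD k []) = some (U', V')) :
    ∃ us', FiOp k us = some us' ∧ us'.length = us.length ∧ us'.getD (k + 1) [] = U' ∧
      us'.getD k [] = V' ∧ ∀ m, m ≠ k → m ≠ k + 1 → us'.getD m [] = us.getD m [] := by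
  refine ⟨(us.set (k + 1) U').set k V', ?_, by simp, ?_, ?_, ?_⟩
  · unfold FiOp
    have e1 : us[k]? = some us[k] := List.getElem?_eq_getElem (by omega)
    have e2 : us[k + 1]? = some us[k + 1] := List.getElem?_eq_getElem (by omega)
    have e3 : us.getD (k + 1) [] = us[k + 1] := by simp [List.getD, e2]
    have e4 : us.getD k [] = us[k] := by simp [List.getD, e1]
    rw [e3, e4] at h
    rw [e1, e2]
    simp [h]
  · simp [List.getD, hk]
  · have : k < us.length := by omega
    simp [List.getD, this]
  · intro m h1 h2
    simp [List.getD, Ne.symm h1, Ne.symm h2]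

theorem iterFi (k a : ℕ) : ∀ (us : List (List ℕ)) (e : ℤ), (∀ m, Str (us.getD m [])) →
    k + 1 < us.length → Mx (us.getD (k + 1) []) (us.getD k []) e →
    (a : ℤ) ≤ e + (us.getD k []).length - (us.getD (k + 1) []).length →
    ∃ (us' : List (List ℕ)) (t : ℕ → ℤ), iterO (FiOp k) a us = some us' ∧ us'.length = us.length ∧
      (∀ m, Str (us'.getD m [])) ∧
      (∀ m, m ≠ k → m ≠ k + 1 → us'.getD m [] = us.getD m []) ∧
      (∀ v, cnt (us'.getD (k + 1) []) v = cnt (us.getD (k + 1) []) v + t v) ∧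
      (∀ v, cnt (us'.getD k []) v = cnt (us.getD k []) v - t v) ∧
      Antitone t ∧ (∀ v, 0 ≤ t v) ∧ (∀ v, t v ≤ a) ∧ t 0 = a ∧
      (∀ v, t v ≤ e - (cnt (us.getD (k + 1) []) v - cnt (us.getD k []) v)) ∧
      ∀ s : ℕ → ℤ, Antitone s → (∀ v, s v ≤ a) →
        (∀ v, s v ≤ e - (cnt (us.getD (k + 1) []) v - cnt (us.getD k []) v)) →
        ∀ v, s v ≤ t v := by
  induction a with
  | zero =>
    intro us e hs hk hM ha
    refine ⟨us, fun _ => 0, rfl, rfl, hs, fun _ _ _ => rfl, by simp, by simp,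
      fun _ _ _ => le_rfl, by simp, by simp, by simp, ?_, ?_⟩
    · intro v; have := hM.1 v; simp only; omega
    · intro s _ h1 _ v; simpa using h1 v
  | succ a ih =>
    intro us e hs hk hM ha
    obtain ⟨y, U', V', hF, hU', hV', hcU, hcV, hy1, hy0, hlt⟩ :=
      pairF_spec (hs (k + 1)) (hs k) hM (by push_cast at ha; omega)
    obtain ⟨us1, hF1, hlen1, hU1, hV1, hoth1⟩ := FiOp_spec k us hk U' V' hF
    have hs1 : ∀ m, Str (us1.getD m []) := by
      intro m
      by_cases h1 : m = k
      · rw [h1, hV1]; exact hV'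
      by_cases h2 : m = k + 1
      · rw [h2, hU1]; exact hU'
      rw [hoth1 m h1 h2]; exact hs m
    have hlU := hcU 0
    have hlV := hcV 0
    simp only [cnt_zero, Nat.zero_le, if_true] at hlU hlV
    have hM1 : Mx (us1.getD (k + 1) []) (us1.getD k []) (e + 1) := by
      rw [hU1, hV1]
      refine ⟨fun v => ?_, y, ?_⟩
      · have h1 := hcU v
        have h2 := hcV v
        have h3 := hM.1 v
        have h4 := hlt v
        split_ifs at h1 h2 <;> omega
      · have h1 := hcU y
        have h2 := hcV y
        simp only [le_refl, if_true] at h1 h2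
        omega
    obtain ⟨us', t, hit, hlen, hs', hoth, htU, htV, hanti, hpos, hle, h0, hbd, hmax⟩ :=
      ih us1 (e + 1) hs1 (by omega) hM1 (by rw [hU1, hV1]; push_cast at ha; omega)
    rw [hU1] at htU hbd hmax
    rw [hV1] at htV hbd hmax
    have hty : ∀ v, y < v → t v = 0 := by
      intro v hv
      have h1 := hanti hv.le
      have h2 := hbd y
      have h3 := hcU y
      have h4 := hcV y
      have h5 := hpos v
      simp only [le_refl, if_true] at h3 h4
      omega
    refine ⟨us', fun v => t v + if v ≤ y then 1 else 0, ?_, by omega, hs', ?_, ?_, ?_, ?_, ?_,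
      ?_, ?_, ?_, ?_⟩
    · simp only [iterO, hF1, Option.bind_some, hit]
    · intro m h1 h2
      rw [hoth m h1 h2, hoth1 m h1 h2]
    · intro v; simp only; rw [htU, hcU]; ring
    · intro v; simp only; rw [htV, hcV]; ring
    · intro v w hvw
      have := hanti hvw
      simp only
      split_ifs <;> omega
    · intro v
      have := hpos v
      simp only
      split_ifs <;> omega
    · intro v
      have := hle v
      simp only
      push_cast
      split_ifs <;> omega
    · simp only [Nat.zero_le, if_true, h0]; push_cast; rfl
    · intro v
      have h1 := hcU v
      have h2 := hcV v
      have h3 := hbd v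
      have h4 := hty v
      have h5 := hM.1 v
      simp only
      split_ifs at h1 h2 ⊢ <;> omega
    · intro s hsa hsl hsb v
      have hsy : ∀ v, y < v → s v ≤ 0 := by
        intro v hv
        have h1 := hsa (show y + 1 ≤ v from hv)
        have h2 := hsb (y + 1)
        omega
      have := hmax (fun v => max (s v - 1) 0) (fun v w hvw => by
          have := hsa hvw
          simp only
          omega) (fun v => by
          have := hsl v
          push_cast at this
          omega) (fun v => by
          have h1 := hcU v
          have h2 := hcV v
          have h3 := hlt v
          have h4 := hsy v
          have h5 := hM.1 v
          have h6 := hsb v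
          split_ifs at h1 h2 <;> omega) v
      have h4 := hsy v
      simp only at this ⊢
      split_ifs <;> omega

theorem iterE (k : ℕ) : ∀ (L R : List ℕ) (b : ℕ), Str L → Str R → Mx L R k →
    b + L.length = k + R.length →
    ∃ (b' : ℕ) (L' R' : List ℕ) (s : ℕ → ℤ), iterO Eop k (b, L, R) = some (b', L', R') ∧ Str L' ∧ Str R' ∧
      (∀ v, cnt L v = cnt L' v + s v) ∧ (∀ v, cnt R' v = cnt R v + s v) ∧
      Antitone s ∧ (∀ v, 0 ≤ s v) ∧ (∀ v, s v ≤ k) ∧ s 0 = k ∧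
      ∀ v, cnt L' v ≤ cnt R v := by
  induction k with
  | zero =>
    intro L R b hL hR hM hb
    refine ⟨b, L, R, fun _ => 0, rfl, hL, hR, by simp, by simp, fun _ _ _ => le_rfl,
      by simp, by simp, by simp, ?_⟩
    intro v; have := hM.1 v; push_cast at this; omega
  | succ k ih =>
    intro L R b hL hR hM hb
    obtain ⟨x, L1, R1, hE, hL1, hR1, hcL, hcR, hx1, hlt⟩ :=
      Eop_spec hL hR hM b (by push_cast; omega) (by push_cast; omega)
    have hlL := hcL 0
    have hlR := hcR 0
    simp only [cnt_zero, Nat.zero_le, if_true] at hlL hlR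
    have hM1 : Mx L1 R1 k := by
      refine ⟨fun v => ?_, x + 1, ?_⟩
      · have h1 := hcL v
        have h2 := hcR v
        have h3 := hM.1 v
        have h4 := hlt v
        push_cast at h3 h4
        split_ifs at h1 h2 <;> omega
      · have h1 := hcL (x + 1)
        have h2 := hcR (x + 1)
        rw [if_neg (by omega)] at h1 h2
        push_cast at hx1
        omega
    obtain ⟨b', L', R', s, hit, hL', hR', hsL, hsR, hanti, hpos, hle, h0, hfin⟩ :=
      ih L1 R1 (b + 1) hL1 hR1 hM1 (by omega)
    have hsx : ∀ v ≤ x, (k : ℤ) ≤ s v := by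
      intro v hv
      have h1 := hanti (show v ≤ x + 1 by omega)
      have h2 := hcL (x + 1)
      have h3 := hcR (x + 1)
      rw [if_neg (by omega)] at h2 h3
      have h4 := hfin (x + 1)
      have h5 := hsL (x + 1)
      push_cast at hx1
      omega
    refine ⟨b', L', R', fun v => s v + if v ≤ x then 1 else 0, ?_, hL', hR', ?_, ?_, ?_, ?_, ?_,
      ?_, ?_⟩
    · simp only [iterO, hE, Option.bind_some, hit]
    · intro v; simp only; rw [hcL, hsL]; ring
    · intro v; simp only; rw [hsR, hcR]; ring
    · intro v w hvw
      have := hanti hvw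
      simp only
      split_ifs <;> omega
    · intro v
      have := hpos v
      simp only
      split_ifs <;> omega
    · intro v
      have := hle v
      simp only
      push_cast
      split_ifs <;> omega
    · simp only [Nat.zero_le, if_true, h0]; push_cast; rfl
    · intro v
      have h1 := hcL v
      have h2 := hcR v
      have h3 := hM.1 v
      have h4 := hfin v
      have h5 := hsL v
      have h6 := hsx v
      push_cast at h3
      split_ifs at h1 h2 <;> omega

theorem aOf_spec (p : List ℕ × List ℕ) (h1 : Str p.1) (h2 : Str p.2) :
    Mx p.1 p.2 (aOf p) ∧ pairOffset p.1 p.2 + p.1.length = aOf p + p.2.length := by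
  have h := offset_Mx h1 h2
  obtain ⟨v, hv⟩ := h.2
  have e1 := cnt_le_length p.1 v
  have e2 := cnt_nonneg p.2 v
  have e3 := h.nonneg
  have e4 : (p.1.length : ℤ) + pairOffset p.1 p.2 - p.2.length = aOf p := by
    unfold aOf
    omega
  rw [e4] at h
  exact ⟨h, by omega⟩

theorem sep_spec (p : List ℕ × List ℕ) (h1 : Str p.1) (h2 : Str p.2) :
    ∃ s : ℕ → ℤ, Str (sepL p) ∧ Str (sepR p) ∧
      (∀ v, cnt p.1 v = cnt (sepL p) v + s v) ∧ (∀ v, cnt (sepR p) v = cnt p.2 v + s v) ∧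
      Antitone s ∧ (∀ v, 0 ≤ s v) ∧ (∀ v, s v ≤ aOf p) ∧ s 0 = aOf p ∧
      ∀ v, cnt (sepL p) v ≤ cnt p.2 v := by
  obtain ⟨hM, hb⟩ := aOf_spec p h1 h2
  obtain ⟨b', L', R', s, hit, hrest⟩ := iterE (aOf p) p.1 p.2 _ h1 h2 hM hb
  have eL : sepL p = L' := by unfold sepL; rw [hit]
  have eR : sepR p = R' := by unfold sepR; rw [hit]
  rw [eL, eR]
  exact ⟨s, hrest⟩

theorem getB_of_cnt {l : List ℕ} (h : Str l) (v i : ℕ) (hi : 1 ≤ i) (hc : (i : ℤ) ≤ cnt l v) :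
    ∃ x, getB l i = some x ∧ v ≤ x := by
  obtain ⟨j, hj, hj1, hj2, hj3⟩ := h.split v
  have hl : i ≤ l.length := by omega
  have g : l[l.length - i]? = some l[l.length - i] := List.getElem?_eq_getElem (by omega)
  refine ⟨_, ?_, hj2 (l.length - i) _ (by omega) g⟩
  unfold getB
  rw [if_pos ⟨hi, hl⟩, g]

theorem cnt_of_getB {l : List ℕ} (h : Str l) {i x : ℕ} (hx : getB l i = some x) :
    cnt l x = i ∧ cnt l (x + 1) + 1 = i := by
  unfold getB at hx
  split_ifs at hx with hi
  have h1 := h.cnt_get hx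
  have h2 := h.cnt_get_succ hx
  omega

theorem col_le {U V : List ℕ} (hU : Str U) (hV : Str V) (d : ℕ)
    (h : ∀ i x y, getB U (i + d) = some x → getB V i = some y → x ≤ y)
    (hl : U.length ≤ V.length + d) (v : ℕ) : cnt U v ≤ cnt V v + d := by
  by_contra hc
  have h0 := cnt_nonneg V v
  have h1 := cnt_le_length U v
  obtain ⟨i, hi⟩ : ∃ i : ℕ, cnt U v = (i : ℤ) + d := ⟨(cnt U v - d).toNat, by omega⟩
  obtain ⟨x, hx, hvx⟩ := getB_of_cnt hU v (i + d) (by omega) (by push_cast; omega)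
  obtain ⟨y, hy, -⟩ := getB_of_cnt hV 0 i (by omega) (by rw [cnt_zero]; omega)
  have := h i x y hx hy
  have h2 := (cnt_of_getB hV hy).1
  have h3 := cnt_anti V (show v ≤ y by omega)
  omega

theorem adm_spec (p₂ p₁ : List ℕ × List ℕ) (h21 : Str p₂.1) (h22 : Str p₂.2)
    (h11 : Str p₁.1) (h12 : Str p₁.2) (hle : aOf p₁ ≤ aOf p₂) (h : Adm p₂ p₁) :
    (∀ v, cnt p₂.2 v ≤ cnt (sepL p₁) v) ∧
    (∀ v, cnt (sepR p₂) v ≤ cnt p₁.1 v + ((aOf p₂ : ℤ) - aOf p₁)) := by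
  obtain ⟨hi, hii, hiii⟩ := h
  obtain ⟨s1, a1, a2, a3, a4, -, -, -, a5, -⟩ := sep_spec p₁ h11 h12
  obtain ⟨s2, b1, b2, b3, b4, -, -, -, b5, -⟩ := sep_spec p₂ h21 h22
  have a30 := a3 0
  have b40 := b4 0
  simp only [cnt_zero] at a30 b40
  constructor
  · intro v
    have := col_le h22 a1 0 (by simpa using hii) (by omega) v
    simpa using this
  · intro v
    have := col_le b2 h11 (aOf p₂ - aOf p₁) hiii (by omega) v
    omega

theorem colsOf_length (ts : List (List ℕ × List ℕ)) :
    (colsOf ts).length = 2 * ts.length := by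
  induction ts with
  | nil => rfl
  | cons a l ih =>
    have : colsOf (a :: l) = a.2 :: a.1 :: colsOf l := by simp [colsOf]
    rw [this]; simp [ih]; omega

theorem colsOf_get (ts : List (List ℕ × List ℕ)) (i : ℕ) :
    (colsOf ts).getD (2 * i) [] = (ts.getD i ([], [])).2 ∧
    (colsOf ts).getD (2 * i + 1) [] = (ts.getD i ([], [])).1 := by
  induction ts generalizing i with
  | nil => simp [colsOf]
  | cons a l ih =>
    have : colsOf (a :: l) = a.2 :: a.1 :: colsOf l := by simp [colsOf]
    rw [this]
    cases i with
    | zero => simp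
    | succ i =>
      have := ih i
      have e : 2 * (i + 1) = 2 * i + 1 + 1 := by ring
      rw [e]
      simpa using this

end KN

namespace KN

theorem inner_loop (p r a N : ℕ) (us0 : List (List ℕ)) (sL s0 : ℕ → ℤ) (u : ℕ → ℕ → ℤ)
    (d : ℤ) (hlen : us0.length = N) (hN : p + r < N)
    (hstr : ∀ m, Str (us0.getD m []))
    (hL : ∀ v, cnt (us0.getD p []) v = sL v + s0 v)
    (hs0 : Antitone s0) (hs0p : ∀ v, 0 ≤ s0 v) (hs0a : ∀ v, s0 v ≤ a) (hs00 : s0 0 = a)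
    (hR : ∀ m, m + 1 = p → ∀ v, sL v ≤ cnt (us0.getD m []) v)
    (hII : ∀ v, cnt (us0.getD (p + 1) []) v ≤ sL v)
    (hdesc : ∀ m, p < m → m + 1 ≤ p + r → ∀ v,
      cnt (us0.getD (m + 1) []) v ≤ cnt (us0.getD m []) v)
    (hua : ∀ m, p < m → m ≤ p + r → Antitone (u m) ∧ ∀ v, u m v ≤ a + d)
    (hu : ∀ m, p < m → m ≤ p + r → ∀ v,
      cnt (us0.getD (m + 1) []) v + u (m + 1) v ≤ cnt (us0.getD m []) v + u m v)
    (hIII : ∀ v, cnt (us0.getD (p + 1) []) v + u (p + 1) v ≤ cnt (us0.getD p []) v + d)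
    (q : ℕ) (hq : q ≤ r) :
    ∃ (us : List (List ℕ)) (w : ℕ → ℕ → ℤ),
      (List.range' (p + 1) q).foldlM
        (fun cur2 k => iterO (FiOp (k - 1)) a cur2) us0 = some us ∧
      us.length = N ∧ (∀ m, Str (us.getD m [])) ∧
      (∀ m, m < p ∨ p + q < m → us.getD m [] = us0.getD m []) ∧
      w p = s0 ∧
      (∀ m, p ≤ m → m ≤ p + q → Antitone (w m) ∧ (∀ v, 0 ≤ w m v) ∧ (∀ v, w m v ≤ a) ∧
        w m 0 = a) ∧
      (∀ m, p ≤ m → m < p + q → ∀ v, w m v ≤ w (m + 1) v) ∧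
      (∀ m, p ≤ m + 1 → m + 1 < p + q → ∀ v,
        cnt (us.getD (m + 1) []) v + w (m + 2) v ≤ cnt (us.getD m []) v + w (m + 1) v) ∧
      (∀ m, m + 1 = p + q → ∀ v,
        cnt (us.getD (m + 1) []) v ≤ cnt (us.getD m []) v + w (m + 1) v) ∧
      (∀ v, cnt (us.getD (p + q) []) v =
        (if q = 0 then sL v else cnt (us0.getD (p + q) []) v) + w (p + q) v) ∧
      (∀ v, cnt (us0.getD (p + q + 1) []) v + u (p + q + 1) v ≤
        cnt (us.getD (p + q) []) v + d) ∧
      (∀ m, p ≤ m → m < p + q → cnt (us.getD m []) 0 =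
        if m = p then sL 0 else cnt (us0.getD m []) 0) := by
  induction q with
  | zero =>
    refine ⟨us0, fun _ => s0, rfl, hlen, hstr, fun _ _ => rfl, rfl,
      fun _ _ _ => ⟨hs0, hs0p, hs0a, hs00⟩, fun m h1 h2 => by omega, fun m h1 h2 => by omega,
      ?_, ?_, ?_, fun m h1 h2 => by omega⟩
    · intro m hm v
      have h1 := hR m (by omega) v
      have h2 := hL v
      have : m + 1 = p := by omega
      rw [this]
      simp only
      omega
    · intro v; simp only [Nat.add_zero, if_true]; exact hL v
    · intro v; simpa using hIII v
  | succ q ih =>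
    obtain ⟨us, w, hfold, hl, hs, hoth, hwp, hw, hmono, hch, htop, hY, hJ, hlen0⟩ :=
      ih (by omega)
    have hUeq : us.getD (p + q + 1) [] = us0.getD (p + q + 1) [] := hoth _ (Or.inr (by omega))
    have hYle : ∀ v, cnt (us0.getD (p + q + 1) []) v ≤
        if q = 0 then sL v else cnt (us0.getD (p + q) []) v := by
      intro v
      split_ifs with h0
      · subst h0; exact hII v
      · exact hdesc (p + q) (by omega) (by omega) v
    obtain ⟨hwa, hwpos, hwle, hw0⟩ := hw (p + q) (by omega) le_rfl
    have hUV : ∀ v, cnt (us.getD (p + q + 1) []) v + w (p + q) v ≤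
        cnt (us.getD (p + q) []) v := by
      intro v
      rw [hUeq, hY v]
      have := hYle v
      omega
    have hM : Mx (us.getD (p + q + 1) []) (us.getD (p + q) []) 0 := by
      refine ⟨fun v => ?_, ?_⟩
      · have h1 := hUV v
        have h2 := hwpos v
        omega
      · obtain ⟨v, h1, h2⟩ := exists_zero (us.getD (p + q + 1) []) (us.getD (p + q) [])
        exact ⟨v, by omega⟩
    have hUV0 := hUV 0
    rw [cnt_zero, cnt_zero, hw0] at hUV0
    obtain ⟨us', t, hit, hl', hs', hoth', htU, htV, hta, htp, htle, ht0, htb, htmax⟩ :=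
      iterFi (p + q) a us 0 hs (by omega) hM (by omega)
    have htw : ∀ v, w (p + q) v ≤ t v := htmax _ hwa hwle (fun v => by
      have := hUV v; omega)
    obtain ⟨hua1, hua2⟩ := hua (p + q + 1) (by omega) (by omega)
    have htu : ∀ v, u (p + q + 1) v - d ≤ t v := htmax (fun v => u (p + q + 1) v - d)
      (fun v v' hv => by have := hua1 hv; simp only; omega)
      (fun v => by have := hua2 v; omega)
      (fun v => by
        have := hJ v
        rw [hUeq]
        omega)
    have hwne : ∀ m, m ≠ p + q + 1 → Function.update w (p + q + 1) t m = w m :=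
      fun m hm => Function.update_of_ne hm _ _
    have hweq : Function.update w (p + q + 1) t (p + q + 1) = t := Function.update_self _ _ _
    refine ⟨us', Function.update w (p + q + 1) t, ?_, by omega, hs', ?_, ?_, ?_, ?_, ?_, ?_,
      ?_, ?_, ?_⟩
    · rw [List.range'_1_concat, List.foldlM_append, hfold]
      have : p + 1 + q - 1 = p + q := by omega
      simp [this, hit]
    · intro m hm
      rw [hoth' m (by omega) (by omega), hoth m (by omega)]
    · rw [hwne p (by omega), hwp]
    · intro m h1 h2
      by_cases hm : m = p + q + 1
      · rw [hm, hweq]; exact ⟨hta, htp, htle, ht0⟩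
      · rw [hwne m hm]; exact hw m h1 (by omega)
    · intro m h1 h2 v
      rw [hwne m (by omega)]
      by_cases hm : m = p + q
      · rw [hm, hweq]; exact htw v
      · rw [hwne (m + 1) (by omega)]; exact hmono m h1 (by omega) v
    · intro m h1 h2 v
      rw [hwne (m + 1) (by omega), hoth' m (by omega) (by omega)]
      by_cases hm : m + 1 = p + q
      · have e2 : m + 2 = p + q + 1 := by omega
        rw [e2, hweq]
        have h3 := htop m hm v
        rw [hm] at h3 ⊢
        have h4 := htV v
        omega
      · rw [hwne (m + 2) (by omega), hoth' (m + 1) (by omega) (by omega)]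
        exact hch m h1 (by omega) v
    · intro m hm v
      have e : m = p + q := by omega
      subst e
      rw [hweq]
      have h1 := htU v
      have h2 := htV v
      have h3 := htb v
      omega
    · intro v
      rw [if_neg (by omega)]
      have e : p + (q + 1) = p + q + 1 := by omega
      rw [e, hweq, htU, hUeq]
    · intro v
      have e : p + (q + 1) = p + q + 1 := by omega
      rw [e, htU, hUeq]
      have h1 := hu (p + q + 1) (by omega) (by omega) v
      have h2 := htu v
      omega
    · intro m h1 h2
      by_cases hm : m = p + q
      · subst hm
        rw [htV, hY, ht0, hw0]
        by_cases h0 : q = 0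
        · simp [h0]
        · rw [if_neg h0, if_neg (by omega)]; ring
      · rw [hoth' m hm (by omega)]
        exact hlen0 m h1 (by omega)

/-- outer invariant -/
def OInv (ℓ : ℕ) (ts : List (List ℕ × List ℕ)) (k : ℕ) (us : List (List ℕ)) : Prop :=
  us.length = 2 * ℓ ∧ (∀ m, Str (us.getD m [])) ∧
  (∀ m, m ≤ 2 * k → us.getD m [] = (colsOf ts).getD m []) ∧
  (∃ u : ℕ → ℕ → ℤ,
    (∀ m, 2 * k ≤ m → m ≤ ℓ + k → Antitone (u m) ∧ ∀ v, u m v ≤ aseqOf ts (k + 1)) ∧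
    (∀ v, u (ℓ + k) v = 0) ∧
    (∀ m, 2 * k ≤ m → m < ℓ + k → ∀ v,
      cnt (us.getD (m + 1) []) v + u (m + 1) v ≤ cnt (us.getD m []) v + u m v) ∧
    (∀ v, cnt (us.getD (2 * k) []) v + u (2 * k) v = cnt (sepR (ts.getD k ([], []))) v) ∧
    (∀ m, 2 * k ≤ m → m + 1 < ℓ + k → ∀ v, u m v ≤ u (m + 1) v)) ∧
  (∀ m, ℓ + k ≤ m → m + 1 < 2 * ℓ → ∀ v, cnt (us.getD (m + 1) []) v - cnt (us.getD m []) v ≤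
    (aseqOf ts (m + 1 - ℓ + 1) : ℤ) - aseqOf ts (m - ℓ + 1)) ∧
  (∀ m, 2 * k ≤ m → m < ℓ + k → (us.getD m []).length = bseqOf ts m) ∧
  (∀ m, ℓ + k ≤ m → m < 2 * ℓ →
    (us.getD m []).length = bseqOf ts m + aseqOf ts (m - ℓ + 1))

theorem outer_init (k : ℕ) (ts : List (List ℕ × List ℕ)) (hlen : ts.length = k + 1)
    (hstr : ∀ j, Str (ts.getD j ([], [])).1 ∧ Str (ts.getD j ([], [])).2) :
    OInv (k + 1) ts k (colsOf ts) := by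
  obtain ⟨s, h1, h2, h3, h4, h5, h6, h7, h8, h9⟩ := sep_spec _ (hstr k).1 (hstr k).2
  have hc := colsOf_get ts k
  have ha : aseqOf ts (k + 1) = aOf (ts.getD k ([], [])) := rfl
  refine ⟨by rw [colsOf_length, hlen], ?_, fun _ _ => rfl,
    ⟨fun m => if m = 2 * k then s else fun _ => 0, ?_, ?_, ?_, ?_, ?_⟩, ?_, ?_, ?_⟩
  · intro m
    rcases Nat.even_or_odd' m with ⟨c, rfl | rfl⟩
    · rw [(colsOf_get ts c).1]; exact (hstr c).2
    · rw [(colsOf_get ts c).2]; exact (hstr c).1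
  · intro m _ _
    simp only
    split_ifs
    · exact ⟨h5, fun v => by rw [ha]; exact h7 v⟩
    · exact ⟨fun _ _ _ => le_rfl, fun v => by positivity⟩
  · intro v
    simp only
    rw [if_neg (by omega)]
  · intro m hm1 hm2 v
    have : m = 2 * k := by omega
    subst this
    rw [hc.1, hc.2]
    simp only [if_true]
    rw [if_neg (by omega)]
    have := h3 v
    have := h9 v
    omega
  · intro v
    simp only [if_true]
    rw [hc.1, h4]
  · intro m _ _; omega
  · intro m _ _; omega
  · intro m hm1 hm2
    have : m = 2 * k := by omega
    subst this
    rw [hc.1]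
    have e : 2 * k / 2 = k := by omega
    simp [bseqOf, e]
  · intro m hm1 hm2
    have : m = 2 * k + 1 := by omega
    subst this
    rw [hc.2]
    have e : (2 * k + 1) / 2 = k := by omega
    have e' : (2 * k + 1) % 2 = 1 := by omega
    have e2 : 2 * k + 1 - (k + 1) + 1 = k + 1 := by omega
    have h30 := h3 0
    rw [cnt_zero, cnt_zero, h8] at h30
    rw [e2, ha]
    unfold bseqOf
    rw [e, if_neg (by omega)]
    omega

theorem outer_step (ℓ k : ℕ) (hk : k + 1 < ℓ) (ts : List (List ℕ × List ℕ))
    (hstr : ∀ j, Str (ts.getD j ([], [])).1 ∧ Str (ts.getD j ([], [])).2)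
    (hmono : aseqOf ts (k + 1) ≤ aseqOf ts (k + 2))
    (hadm : Adm (ts.getD (k + 1) ([], [])) (ts.getD k ([], [])))
    (us0 : List (List ℕ)) (h0 : OInv ℓ ts (k + 1) us0) :
    ∃ us, (List.range' (2 * (k + 1)) (ℓ - (k + 1))).foldlM
        (fun cur2 k' => iterO (FiOp (k' - 1)) (aseqOf ts (k + 1)) cur2) us0 = some us ∧
      OInv ℓ ts k us := by
  obtain ⟨hlen, hs, hor, ⟨u, hu1, hu2, hu3, hu4, hu5⟩, hbey, hl1, hl2⟩ := h0
  have ha1 : aseqOf ts (k + 1) = aOf (ts.getD k ([], [])) := rfl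
  have ha2 : aseqOf ts (k + 2) = aOf (ts.getD (k + 1) ([], [])) := rfl
  obtain ⟨s, h1, h2, h3, h4, h5, h6, h7, h8, h9⟩ := sep_spec _ (hstr k).1 (hstr k).2
  obtain ⟨hA, hB⟩ := adm_spec _ _ (hstr (k + 1)).1 (hstr (k + 1)).2 (hstr k).1 (hstr k).2
    (by rw [← ha1, ← ha2]; exact hmono) hadm
  rw [← ha1] at h7 h8 hB
  rw [← ha2] at hB
  have hc := colsOf_get ts k
  have hc' := (colsOf_get ts (k + 1)).1
  have g0 : us0.getD (2 * k) [] = (ts.getD k ([], [])).2 := by rw [hor _ (by omega), hc.1]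
  have g1 : us0.getD (2 * k + 1) [] = (ts.getD k ([], [])).1 := by rw [hor _ (by omega), hc.2]
  have g2 : us0.getD (2 * k + 1 + 1) [] = (ts.getD (k + 1) ([], [])).2 := by
    have := hor (2 * (k + 1)) le_rfl
    rw [hc'] at this
    exact this
  have hpr : 2 * k + 1 + (ℓ - (k + 1)) = ℓ + k := by omega
  obtain ⟨us, w, hfold, hl, hst, hoth, hwp, hw, hwm, hch, htop, hY, hJ, hz⟩ :=
    inner_loop (2 * k + 1) (ℓ - (k + 1)) (aseqOf ts (k + 1)) (2 * ℓ) us0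
      (cnt (sepL (ts.getD k ([], [])))) s u
      ((aseqOf ts (k + 2) : ℤ) - aseqOf ts (k + 1)) hlen (by omega) hs
      (by intro v; rw [g1]; exact h3 v) h5 h6 h7 h8
      (by
        intro m hm v
        have : m = 2 * k := by omega
        rw [this, g0]; exact h9 v)
      (by intro v; rw [g2]; exact hA v)
      (by
        intro m hm1 hm2 v
        have e1 := hu3 m (by omega) (by omega) v
        have e2 := hu5 m (by omega) (by omega) v
        omega)
      (by
        intro m hm1 hm2
        refine ⟨(hu1 m (by omega) (by omega)).1, fun v => ?_⟩
        have := (hu1 m (by omega) (by omega)).2 v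
        have e : k + 1 + 1 = k + 2 := rfl
        rw [e] at this
        omega)
      (by
        intro m hm1 hm2 v
        exact hu3 m (by omega) (by omega) v)
      (by
        intro v
        have e1 := hu4 v
        have e2 := hB v
        have e : 2 * (k + 1) = 2 * k + 1 + 1 := by omega
        rw [e] at e1
        rw [e1, g1]
        exact e2)
      (ℓ - (k + 1)) le_rfl
  rw [hpr] at hoth hw hwm hch htop hY hJ hz
  refine ⟨us, hfold, hl, hst, ?_, ⟨fun m => if m < ℓ + k then w (m + 1) else fun _ => 0,
    ?_, ?_, ?_, ?_, ?_⟩, ?_, ?_, ?_⟩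
  · intro m hm
    rw [hoth m (by omega), hor m (by omega)]
  · intro m hm1 hm2
    simp only
    split_ifs with hlt
    · obtain ⟨e1, e2, e3, e4⟩ := hw (m + 1) (by omega) (by omega)
      exact ⟨e1, e3⟩
    · exact ⟨fun _ _ _ => le_rfl, fun v => by positivity⟩
  · intro v; simp
  · intro m hm1 hm2 v
    simp only
    rw [if_pos hm2]
    by_cases hlt : m + 1 < ℓ + k
    · rw [if_pos hlt]
      exact hch m (by omega) hlt v
    · rw [if_neg hlt]
      have := htop m (by omega) v
      simpa using this
  · intro v
    simp only
    rw [if_pos (by omega), hwp, h4, hoth _ (by omega), g0]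
  · intro m hm1 hm2 v
    simp only
    rw [if_pos (by omega), if_pos (by omega)]
    exact hwm (m + 1) (by omega) (by omega) v
  · intro m hm1 hm2 v
    by_cases hm : m = ℓ + k
    · subst hm
      have e1 := hJ v
      have e2 := hu2 v
      have e3 : ℓ + k + 1 - ℓ + 1 = k + 2 := by omega
      have e4 : ℓ + k - ℓ + 1 = k + 1 := by omega
      have e5 : ℓ + (k + 1) = ℓ + k + 1 := by omega
      rw [e5] at e2
      rw [e3, e4, hoth (ℓ + k + 1) (by omega)]
      omega
    · rw [hoth m (by omega), hoth (m + 1) (by omega)]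
      exact hbey m (by omega) hm2 v
  · intro m hm1 hm2
    by_cases hm : m = 2 * k
    · subst hm
      rw [hoth _ (by omega), g0]
      have e : 2 * k / 2 = k := by omega
      simp [bseqOf, e]
    · have e1 := hz m (by omega) hm2
      rw [cnt_zero] at e1
      by_cases hm' : m = 2 * k + 1
      · subst hm'
        rw [if_pos rfl, cnt_zero] at e1
        have e2 := h3 0
        rw [cnt_zero, cnt_zero, h8, ha1] at e2
        have e : (2 * k + 1) / 2 = k := by omega
        unfold bseqOf
        rw [e, if_neg (by omega)]
        omega
      · rw [if_neg hm', cnt_zero] at e1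
        rw [← hl1 m (by omega) (by omega)]
        exact_mod_cast e1
  · intro m hm1 hm2
    by_cases hm : m = ℓ + k
    · subst hm
      have e1 := hY 0
      have e4 : ℓ + k - ℓ + 1 = k + 1 := by omega
      rw [if_neg (by omega), (hw (ℓ + k) (by omega) le_rfl).2.2.2, cnt_zero, cnt_zero,
        hl1 (ℓ + k) (by omega) (by omega)] at e1
      rw [e4]
      exact_mod_cast e1
    · rw [hoth m (by omega)]
      exact hl2 m (by omega) hm2

theorem Str_of_chain {l : List ℕ} (h : l.Chain' (· < ·)) : Str l :=
  List.isChain_iff_pairwise.1 h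

theorem chain_of_Str {l : List ℕ} (h : Str l) : l.Chain' (· < ·) :=
  List.isChain_iff_pairwise.2 h

theorem rows_of_cnt {U V : List ℕ} (hU : Str U) (hV : Str V) (d₁ d₂ : ℕ)
    (h : ∀ v, cnt U v - cnt V v ≤ (d₁ : ℤ) - d₂) (p q x y : ℕ) (hq : q + d₂ = p + d₁)
    (hx : getB U q = some x) (hy : getB V p = some y) : x ≤ y := by
  by_contra hc
  have h1 := (cnt_of_getB hU hx).1
  have h2 := (cnt_of_getB hV hy).2
  have h3 := cnt_anti V (show y + 1 ≤ x by omega)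
  have h4 := h x
  omega

end KN

open KN

theorem separation_semistandard (n ℓ : ℕ) (hn : 2 ≤ n) (hl : 1 ≤ ℓ)
    (ts : List (List ℕ × List ℕ)) (hlen : ts.length = ℓ)
    (hcomp : ∀ j, j < ℓ → ts.getD j ([], []) ∈ TGSet n (aseqOf ts (j + 1)))
    (hmono : ∀ j, j + 1 < ℓ → aseqOf ts (j + 1) ≤ aseqOf ts (j + 2))
    (hadm : ∀ j, j + 1 < ℓ → Adm (ts.getD (j + 1) ([], [])) (ts.getD j ([], []))) :
    ∃ us', separate ℓ (aseqOf ts) (colsOf ts) = some us' ∧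
      us'.length = 2 * ℓ ∧
      (∀ col ∈ us', col.Chain' (· < ·)) ∧
      (∀ m, m < ℓ → (us'.getD m []).length = bseqOf ts m) ∧
      (∀ m, ℓ ≤ m → m < 2 * ℓ →
          (us'.getD m []).length = bseqOf ts m + aseqOf ts (m - ℓ + 1)) ∧
      (∀ m p q x y, m + 1 < 2 * ℓ →
          q + depth ℓ (aseqOf ts) m = p + depth ℓ (aseqOf ts) (m + 1) →
          getB (us'.getD (m + 1) []) q = some x → getB (us'.getD m []) p = some y →
          x ≤ y) := by
  have hstr : ∀ j, Str (ts.getD j ([], [])).1 ∧ Str (ts.getD j ([], [])).2 := by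
    intro j
    by_cases hj : j < ℓ
    · obtain ⟨-, ⟨h1, h2, -⟩, -⟩ := hcomp j hj
      exact ⟨Str_of_chain h1, Str_of_chain h2⟩
    · have : ts.getD j ([], []) = ([], []) := by
        rw [List.getD_eq_default]; omega
      rw [this]
      exact ⟨List.Pairwise.nil, List.Pairwise.nil⟩
  have hmain : ∀ c, c ≤ ℓ - 1 → ∃ us, (List.range c).foldlM
      (fun cur j' =>
        let j := ℓ - 1 - j'
        (List.range' (2 * j) (ℓ - j)).foldlM
          (fun cur2 k => iterO (FiOp (k - 1)) (aseqOf ts j) cur2) cur) (colsOf ts) = some us ∧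
      OInv ℓ ts (ℓ - 1 - c) us := by
    intro c
    induction c with
    | zero =>
      intro _
      refine ⟨colsOf ts, rfl, ?_⟩
      have := outer_init (ℓ - 1) ts (by omega) hstr
      have e : ℓ - 1 + 1 = ℓ := by omega
      rw [e] at this
      exact this
    | succ c ih =>
      intro hc
      obtain ⟨us0, hf, hI⟩ := ih (by omega)
      obtain ⟨k, hk⟩ : ∃ k, ℓ - 1 - c = k + 1 := ⟨ℓ - 1 - c - 1, by omega⟩
      have hk' : ℓ - 1 - (c + 1) = k := by omega
      rw [hk] at hI
      obtain ⟨us, hf2, hI2⟩ := outer_step ℓ k (by omega) ts hstr (hmono k (by omega))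
        (hadm k (by omega)) us0 hI
      refine ⟨us, ?_, by rw [hk']; exact hI2⟩
      rw [List.range_succ, List.foldlM_append, hf]
      simp only [List.foldlM_cons, List.foldlM_nil, hk, Option.bind_eq_bind, Option.bind_some,
        hf2]
      rfl
  obtain ⟨us, hf, hI⟩ := hmain (ℓ - 1) le_rfl
  rw [Nat.sub_self] at hI
  obtain ⟨hlen', hs, hor, ⟨u, hu1, hu2, hu3, hu4, hu5⟩, hbey, hl1, hl2⟩ := hI
  simp only [Nat.mul_zero, Nat.add_zero, Nat.zero_add] at *
  refine ⟨us, hf, hlen', ?_, ?_, ?_, ?_⟩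
  · intro col hcol
    obtain ⟨i, hi⟩ := List.mem_iff_getElem?.1 hcol
    have := hs i
    rw [List.getD, hi] at this
    exact chain_of_Str this
  · intro m hm; exact hl1 m (Nat.zero_le _) hm
  · intro m h1 h2; exact hl2 m h1 h2
  · intro m p q x y hm hpq hx hy
    refine rows_of_cnt (hs (m + 1)) (hs m) (depth ℓ (aseqOf ts) (m + 1))
      (depth ℓ (aseqOf ts) m) (fun v => ?_) p q x y hpq hx hy
    unfold depth
    by_cases h1 : m + 1 < ℓ
    · rw [if_pos h1, if_pos (by omega)]
      have e1 := hu3 m (Nat.zero_le _) (by omega) v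
      have e2 := hu5 m (Nat.zero_le _) h1 v
      push_cast
      omega
    · by_cases h2 : m < ℓ
      · rw [if_neg h1, if_pos h2]
        have e0 : m + 1 = ℓ := by omega
        have e1 := hu3 m (Nat.zero_le _) h2 v
        have e2 := hu2 v
        have e3 := (hu1 m (Nat.zero_le _) (by omega)).2 v
        have e4 : m + 1 - ℓ + 1 = 1 := by omega
        rw [e4]
        rw [← e0] at e2
        push_cast
        omega
      · rw [if_neg h1, if_neg h2]
        exact hbey m (by omega) hm v
end

section
/- The symmetry of RSK restricted to column insertion of matrices over [n̄]: for a finitely supported ℤ≥0-matrix m indexed by [n̄]×[n̄], the insertion tableau P(m) (obtained by reverse column-inserting the row words of m from the n̄-th row word down to the 1̄-st) satisfies P(m) = P(m^t) if and only if m = m^t; consequently m ↦ P(m) is a bijection from symmetric matrices in M onto the disjoint union over all partitions μ of SST_{[n̄]}(μ^π). -/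
/-!
Statement 15: symmetry of RSK for reverse column insertion over `[n̄]`: for a finitely
supported `ℤ≥0`-matrix `m` indexed by `[n̄] × [n̄]`, the insertion tableau `P(m)` satisfies
`P(m) = P(mᵗ)` if and only if `m = mᵗ`; consequently `m ↦ P(m)` is a bijection from the
symmetric matrices onto `⊔_μ SST_{[n̄]}(μ^π)`.

Encoding: the alphabet `[n̄] = {n̄ < ⋯ < 1̄}` is `Fin n`/`ℕ` with the code of `j̄` equal to
`n − j`; matrices are `Fin n → Fin n → ℕ` (finite, hence finitely supported).  A tableau
of rotated shape `μ^π` is the list of its columns, rightmost (tallest) first, each column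
strictly increasing top-to-bottom, columns bottom-aligned with weakly increasing rows.
Reverse column insertion of a letter `x` bumps the bottommost entry `≤ x` of the current
column (starting with the rightmost column) and puts `x` in its place, the bumped letter
being inserted in the next column to the left; if there is no such entry, `x` is added on
top of the column.
-/

namespace RSK

/-- Reverse column insertion of `x` into a single column: returns the new column and the
bumped entry (if any). -/
def colInsert (x : ℕ) (c : List ℕ) : List ℕ × Option ℕ :=
  match (List.range c.length).reverse.find? (fun i => decide (c.getD i 0 ≤ x)) with
  | none => (x :: c, none)
  | some i => (c.set i x, some (c.getD i 0))

/-- Reverse column insertion of `x` into a tableau (list of columns, rightmost first). -/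
def tabInsert (x : ℕ) : List (List ℕ) → List (List ℕ)
  | [] => [[x]]
  | c :: rest =>
      match colInsert x c with
      | (c', none) => c' :: rest
      | (c', some y) => c' :: tabInsert y rest

/-- The row word `w(m)_ī` of the `ī`-th row of `m` (read right-to-left, i.e. with codes
weakly decreasing). -/
def rowWordOf (n : ℕ) (m : Fin n → Fin n → ℕ) (a : Fin n) : List ℕ :=
  (List.finRange n).reverse.flatMap fun b => List.replicate (m a b) (b : ℕ)

/-- The word `w(m)_n̄ ⋯ w(m)_1̄` of `m`. -/
def wordOf (n : ℕ) (m : Fin n → Fin n → ℕ) : List ℕ :=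
  (List.finRange n).flatMap (rowWordOf n m)

/-- The insertion tableau `P(m) = (((w_r ← w_{r−1}) ⋯ ) ← w_1)`. -/
def Pm (n : ℕ) (m : Fin n → Fin n → ℕ) : List (List ℕ) :=
  (wordOf n m).foldr tabInsert []

/-- Membership in `⊔_μ SST_{[n̄]}(μ^π)`: a list of nonempty columns, rightmost first,
strictly increasing with weakly decreasing heights, bottom-aligned rows weakly
increasing left-to-right, entries `< n`. -/
def IsRotSST (n : ℕ) (t : List (List ℕ)) : Prop :=
  (∀ c ∈ t, c ≠ [] ∧ c.Chain' (· < ·) ∧ ∀ x ∈ c, x < n) ∧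
  (t.map List.length).Chain' (· ≥ ·) ∧
  ∀ j ρ x y,
    (if 1 ≤ ρ ∧ ρ ≤ (t.getD (j+1) []).length
      then (t.getD (j+1) [])[(t.getD (j+1) []).length - ρ]? else none) = some x →
    (if 1 ≤ ρ ∧ ρ ≤ (t.getD j []).length
      then (t.getD j [])[(t.getD j []).length - ρ]? else none) = some y →
    x ≤ y

end RSK

namespace RSK

/-- number of entries `≥ b`. -/
def cnt (b : ℕ) (c : List ℕ) : ℕ := c.countP (fun x => decide (b ≤ x))

@[simp] lemma cnt_nil (b : ℕ) : cnt b [] = 0 := rfl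
lemma cnt_cons (b x : ℕ) (c : List ℕ) : cnt b (x :: c) = cnt b c + if b ≤ x then 1 else 0 := by
  simp [cnt, List.countP_cons]
lemma cnt_append (b : ℕ) (c d : List ℕ) : cnt b (c ++ d) = cnt b c + cnt b d := by
  simp [cnt, List.countP_append]
lemma cnt_all (b : ℕ) (c : List ℕ) (h : ∀ z ∈ c, b ≤ z) : cnt b c = c.length := by
  simpa [cnt, List.countP_eq_length] using h
lemma cnt_none (b : ℕ) (c : List ℕ) (h : ∀ z ∈ c, z < b) : cnt b c = 0 := by
  simpa [cnt, List.countP_eq_zero] using h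

lemma colInsert_cases (x : ℕ) (c : List ℕ) :
    (colInsert x c = (x :: c, none) ∧ ∀ y ∈ c, x < y) ∨
    ∃ l₁ y l₂, c = l₁ ++ y :: l₂ ∧ y ≤ x ∧ (∀ z ∈ l₂, x < z) ∧
      colInsert x c = (l₁ ++ x :: l₂, some y) := by
  unfold colInsert
  rcases hf : (List.range c.length).reverse.find? (fun i => decide (c.getD i 0 ≤ x)) with _ | i
  · left
    refine ⟨rfl, fun y hy => ?_⟩
    rw [List.find?_eq_none] at hf
    obtain ⟨i, hi, rfl⟩ := List.getElem_of_mem hy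
    have := hf i (by simpa using hi)
    simpa [hi] using this
  · right
    rw [List.find?_eq_some_iff_append] at hf
    obtain ⟨hp, as, bs, hab, has⟩ := hf
    have hi : i < c.length := by
      have : i ∈ (List.range c.length).reverse := by rw [hab]; simp
      simpa using this
    have hpw : (as ++ i :: bs).Pairwise (· > ·) := by
      rw [← hab, List.pairwise_reverse]
      exact List.pairwise_lt_range
    refine ⟨c.take i, c.getD i 0, c.drop (i+1), ?_, ?_, ?_, ?_⟩
    · rw [List.getD_eq_getElem _ _ hi]; simp
    · simpa [hi] using hp
    · intro z hz
      obtain ⟨j, hj, rfl⟩ := List.getElem_of_mem hz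
      have hj' : i + 1 + j < c.length := by simp at hj; omega
      have hm : (i + 1 + j) ∈ as ++ i :: bs := by rw [← hab]; simpa using hj'
      rw [List.pairwise_append] at hpw
      have hm2 : (i + 1 + j) ∈ as := by
        rcases List.mem_append.1 hm with h | h
        · exact h
        · rcases List.mem_cons.1 h with h | h
          · omega
          · have := (List.pairwise_cons.1 hpw.2.1).1 _ h
            omega
      have := has _ hm2
      simpa [hj'] using this
    · simp [hi, List.set_eq_take_append_cons_drop]

/-- Insert a word (from the right) into the column `c`; returns new column and bumped word. -/
def cf (c : List ℕ) : List ℕ → List ℕ × List ℕ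
  | [] => (c, [])
  | x :: w =>
      match colInsert x (cf c w).1 with
      | (c', none) => (c', (cf c w).2)
      | (c', some y) => (c', y :: (cf c w).2)

lemma cf_append (c u w : List ℕ) :
    cf c (u ++ w) = ((cf (cf c w).1 u).1, (cf (cf c w).1 u).2 ++ (cf c w).2) := by
  induction u with
  | nil => simp [cf]
  | cons x u ih =>
    simp only [List.cons_append, cf, ih]
    rcases h : colInsert x (cf (cf c w).1 u).1 with ⟨c', _ | y⟩ <;> simp

/-- the heights. -/
def H : List ℕ → ℕ → ℕ
  | [], _ => 0
  | x :: w, b => if b ≤ x then max (H w b) (H w (x+1) + 1) else H w b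

lemma cf_cons_cases (c : List ℕ) (x : ℕ) (w : List ℕ) :
    (cf c (x :: w) = (x :: (cf c w).1, (cf c w).2) ∧ ∀ y ∈ (cf c w).1, x < y) ∨
    ∃ l₁ y l₂, (cf c w).1 = l₁ ++ y :: l₂ ∧ y ≤ x ∧ (∀ z ∈ l₂, x < z) ∧
      cf c (x :: w) = (l₁ ++ x :: l₂, y :: (cf c w).2) := by
  rcases colInsert_cases x (cf c w).1 with ⟨h, h2⟩ | ⟨l₁, y, l₂, h1, h2, h3, h4⟩
  · left; refine ⟨?_, h2⟩; simp [cf, h]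
  · right; refine ⟨l₁, y, l₂, h1, h2, h3, ?_⟩; simp [cf, h4]

lemma cf_perm (c w : List ℕ) : ((cf c w).1 ++ (cf c w).2).Perm (w ++ c) := by
  induction w with
  | nil => simp [cf]
  | cons x w ih =>
    rw [← Multiset.coe_eq_coe] at ih ⊢
    rcases cf_cons_cases c x w with ⟨h, -⟩ | ⟨l₁, y, l₂, h1, h2, h3, h⟩
    · rw [h]; simpa using ih
    · rw [h]
      rw [h1] at ih
      simp only [← Multiset.coe_add, ← Multiset.cons_coe, List.cons_append] at ih ⊢
      rw [← ih]
      simp only [← Multiset.singleton_add]; abel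

lemma cf_sorted_of (c w : List ℕ) (hc : c.Pairwise (· < ·)) : (cf c w).1.Pairwise (· < ·) := by
  induction w with
  | nil => simpa [cf] using hc
  | cons x w ih =>
    rcases cf_cons_cases c x w with ⟨h, h1⟩ | ⟨l₁, y, l₂, h1, h2, h3, h⟩
    · rw [h]; exact List.pairwise_cons.2 ⟨h1, ih⟩
    · rw [h]
      rw [h1, List.pairwise_append, List.pairwise_cons] at ih
      simp only [List.pairwise_append, List.pairwise_cons]
      refine ⟨ih.1, ⟨h3, ih.2.1.2⟩, fun a ha b hb => ?_⟩
      have h5 := ih.2.2 a ha y (by simp)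
      rcases List.mem_cons.1 hb with rfl | hb
      · omega
      · have := h3 b hb; omega

lemma cf_sorted (w : List ℕ) : (cf [] w).1.Pairwise (· < ·) := cf_sorted_of _ _ (by simp)

lemma cnt_cf (w : List ℕ) (b : ℕ) : cnt b (cf [] w).1 = H w b := by
  induction w generalizing b with
  | nil => simp [cf, H]
  | cons x w ih =>
    have hs := cf_sorted w
    have e1 := ih b
    have e2 := ih (x+1)
    simp only [H]
    rcases cf_cons_cases [] x w with ⟨h, h1⟩ | ⟨l₁, y, l₂, h1, h2, h3, h⟩
    · rw [h, cnt_cons, ← e1, ← e2, cnt_all (x+1) _ h1]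
      split_ifs with hb
      · rw [cnt_all b _ (fun z hz => by have := h1 z hz; omega)]; omega
      · rfl
    · rw [h]
      rw [h1, List.pairwise_append, List.pairwise_cons] at hs
      rw [← e1, ← e2, h1]
      simp only [cnt_append, cnt_cons]
      have hl1 : ∀ z ∈ l₁, z < y := fun z hz => hs.2.2 z hz y (by simp)
      rw [cnt_none (x+1) l₁ (fun z hz => by have := hl1 z hz; omega),
        cnt_all (x+1) l₂ h3]
      split_ifs with hb hb2 hb3 <;> try omega
      · rw [cnt_all b l₂ (fun z hz => by have := h3 z hz; omega)]; omega
      · rw [cnt_all b l₂ (fun z hz => by have := h3 z hz; omega),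
          cnt_none b l₁ (fun z hz => by have := hl1 z hz; omega)]; omega

/-- insertion tableau of a word -/
def PW (w : List ℕ) : List (List ℕ) := w.foldr tabInsert []

lemma cf_ne_nil (x : ℕ) (w : List ℕ) : (cf [] (x :: w)).1 ≠ [] := by
  rcases cf_cons_cases [] x w with ⟨h, -⟩ | ⟨l₁, y, l₂, h1, h2, h3, h⟩ <;> rw [h] <;> simp

lemma PW_eq (w : List ℕ) (hw : w ≠ []) : PW w = (cf [] w).1 :: PW (cf [] w).2 := by
  induction w with
  | nil => exact absurd rfl hw
  | cons x w ih =>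
    by_cases h0 : w = []
    · subst h0; simp [PW, tabInsert, cf, colInsert]
    · have := ih h0
      change tabInsert x (PW w) = _
      rw [this]
      simp only [tabInsert, cf]
      rcases colInsert x (cf [] w).1 with ⟨c', _ | y⟩
      · simp
      · simp [PW]

lemma PW_eq_nil (w : List ℕ) : PW w = [] ↔ w = [] := by
  constructor
  · intro h; by_contra h0; rw [PW_eq w h0] at h; simp at h
  · rintro rfl; rfl

lemma cf_row_sorted (c u : List ℕ) (hc : c.Pairwise (· < ·)) (hu : u.Pairwise (· ≥ ·)) :
    (cf c u).2.Pairwise (· ≥ ·) ∧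
      ∀ x ∈ u.head?, x ∈ (cf c u).1 ∧ ∀ y ∈ (cf c u).2, y ≤ x := by
  induction u with
  | nil => simp [cf]
  | cons x u ih =>
    rw [List.pairwise_cons] at hu
    obtain ⟨i1, i2⟩ := ih hu.2
    have key : ∀ y ∈ (cf c u).2, y ≤ x := by
      intro y hy
      cases u with
      | nil => simp [cf] at hy
      | cons x' u =>
        have := (i2 x' (by simp)).2 y hy
        have := hu.1 x' (by simp)
        omega
    rcases cf_cons_cases c x u with ⟨h, h1⟩ | ⟨l₁, y, l₂, h1, h2, h3, h⟩
    · rw [h]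
      simp only [List.head?_cons, Option.mem_some_iff]
      refine ⟨i1, ?_⟩
      rintro _ rfl
      exact ⟨by simp, key⟩
    · rw [h]
      have hy : ∀ z ∈ (cf c u).2, z ≤ y := by
        intro z hz
        cases u with
        | nil => simp [cf] at hz
        | cons x' u =>
          obtain ⟨j1, j2⟩ := i2 x' (by simp)
          have k1 := j2 z hz
          have k2 := hu.1 x' (by simp)
          have hs := cf_sorted_of c (x' :: u) hc
          rw [h1, List.pairwise_append] at hs
          rw [h1] at j1
          rcases List.mem_append.1 j1 with j | j
          · have := hs.2.2 x' j y (by simp); omega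
          · rcases List.mem_cons.1 j with rfl | j
            · exact k1
            · have := h3 x' j; omega
      simp only [List.head?_cons, Option.mem_some_iff]
      refine ⟨List.pairwise_cons.2 ⟨hy, i1⟩, ?_⟩
      rintro _ rfl
      refine ⟨by simp, fun z hz => ?_⟩
      rcases List.mem_cons.1 hz with rfl | hz
      · exact h2
      · exact key z hz

lemma H_append_of_lt (u w : List ℕ) (b : ℕ) (h : ∀ x ∈ u, x < b) : H (u ++ w) b = H w b := by
  induction u with
  | nil => rfl
  | cons x u ih =>
    have h1 := h x (by simp)
    simp only [List.cons_append, H]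
    rw [if_neg (by omega), ih (fun y hy => h y (by simp [hy]))]

lemma H_row (u w : List ℕ) (hu : u.Pairwise (· ≥ ·)) (b N : ℕ) :
    H (u ++ w) b ≤ N ↔ H w b ≤ N ∧ ∀ x ∈ u, b ≤ x → H w (x+1) + 1 ≤ N := by
  induction u with
  | nil => simp
  | cons x u ih =>
    rw [List.pairwise_cons] at hu
    have i := ih hu.2
    simp only [List.cons_append, H]
    rw [H_append_of_lt u w (x+1) (fun y hy => by have := hu.1 y hy; omega)]
    simp only [List.mem_cons, forall_eq_or_imp]
    split_ifs with hb
    · rw [max_le_iff, i]; tauto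
    · rw [i]; tauto

/-- the `i`-th row word (reversed indices). -/
def row (n : ℕ) (M : ℕ → ℕ → ℕ) (i : ℕ) : List ℕ :=
  (List.range n).flatMap fun k => List.replicate (M i k) (n - 1 - k)

/-- the word of the first `I` rows (reversed indices). -/
def Wd (n : ℕ) (M : ℕ → ℕ → ℕ) : ℕ → List ℕ
  | 0 => []
  | i + 1 => row n M i ++ Wd n M i

lemma mem_row (n : ℕ) (M : ℕ → ℕ → ℕ) (i x : ℕ) :
    x ∈ row n M i ↔ ∃ k < n, 0 < M i k ∧ x = n - 1 - k := by
  simp [row, Nat.pos_iff_ne_zero]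

lemma row_sorted (n : ℕ) (M : ℕ → ℕ → ℕ) (i : ℕ) : (row n M i).Pairwise (· ≥ ·) := by
  unfold row
  rw [List.pairwise_flatMap]
  constructor
  · intro a _; simp [List.pairwise_replicate]
  · refine (List.pairwise_lt_range (n := n)).imp ?_
    intro a b hab x hx y hy
    rw [List.eq_of_mem_replicate hx, List.eq_of_mem_replicate hy]
    show n - 1 - b ≤ n - 1 - a
    omega

lemma count_row (n : ℕ) (M : ℕ → ℕ → ℕ) (i k : ℕ) (hk : k < n) :
    (row n M i).count (n - 1 - k) = M i k := by
  unfold row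
  rw [List.count_flatMap]
  have : ∀ m ≤ n, ((List.range m).map
      (List.count (n - 1 - k) ∘ fun k => List.replicate (M i k) (n - 1 - k))).sum
        = if k < m then M i k else 0 := by
    intro m
    induction m with
    | zero => simp
    | succ m ih =>
      intro hm
      rw [List.range_succ, List.map_append, List.sum_append, ih (by omega)]
      simp only [List.map_cons, List.map_nil, List.sum_cons, List.sum_nil, Function.comp,
        List.count_replicate, beq_iff_eq]
      by_cases h1 : k < m
      · rw [if_pos h1, if_neg (by omega), if_pos (by omega)]; rfl
      · by_cases h2 : k = m
        · subst h2; simp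
        · rw [if_neg h1, if_neg (by omega), if_neg (by omega)]; rfl
  rw [this n le_rfl, if_pos hk]

/-- The growth function of the first column. -/
def G (M : ℕ → ℕ → ℕ) : ℕ → ℕ → ℕ
  | 0, _ => 0
  | _ + 1, 0 => 0
  | i + 1, k + 1 => max (max (G M i (k+1)) (G M (i+1) k)) (if 0 < M i k then G M i k + 1 else 0)

lemma H_Wd_of_ge (n : ℕ) (M : ℕ → ℕ → ℕ) (i b : ℕ) (hb : n ≤ b) : H (Wd n M i) b = 0 := by
  induction i with
  | zero => rfl
  | succ i ih =>
    rw [Wd, H_append_of_lt _ _ _ (fun x hx => ?_), ih]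
    obtain ⟨k, h1, -, rfl⟩ := (mem_row ..).1 hx
    omega

lemma H_Wd (n : ℕ) (M : ℕ → ℕ → ℕ) (i k : ℕ) (hk : k ≤ n) :
    H (Wd n M i) (n - k) = G M i k := by
  induction i generalizing k with
  | zero => simp [Wd, H, G]
  | succ i ih =>
    induction k with
    | zero => rw [H_Wd_of_ge _ _ _ _ (by omega)]; simp [G]
    | succ k ihk =>
      have h2 := ihk (by omega)
      simp only [G]
      rw [← h2, ← ih (k+1) hk, ← ih k (by omega)]
      apply eq_of_forall_ge_iff
      intro N
      simp only [Wd, max_le_iff, H_row _ _ (row_sorted n M i)]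
      have hmono : H (Wd n M i) (n - k) ≤ H (Wd n M i) (n - (k+1)) := by
        rw [← cnt_cf, ← cnt_cf]
        apply List.countP_mono_left
        intro x _ hx
        simp only [decide_eq_true_eq] at hx ⊢
        omega
      constructor
      · rintro ⟨h3, h4⟩
        refine ⟨⟨h3, le_trans hmono h3, fun x hx hb => h4 x hx (by omega)⟩, ?_⟩
        split_ifs with hm
        · have := h4 (n - 1 - k) ((mem_row ..).2 ⟨k, by omega, hm, rfl⟩) (by omega)
          rwa [show n - 1 - k + 1 = n - k by omega] at this
        · omega
      · rintro ⟨⟨h3, h4, h5⟩, h6⟩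
        refine ⟨h3, fun x hx hb => ?_⟩
        by_cases hx2 : n - k ≤ x
        · exact h5 x hx hx2
        · obtain ⟨k', hk', hm, rfl⟩ := (mem_row ..).1 hx
          have : k' = k := by omega
          subst this
          rw [if_pos hm] at h6
          rwa [show n - 1 - k' + 1 = n - k' by omega]

/-- The matrix of bumped letters. -/
def nxt (M : ℕ → ℕ → ℕ) (i k : ℕ) : ℕ :=
  M i k + G M i (k+1) + G M (i+1) k - G M i k - G M (i+1) (k+1)

lemma G_le_right (M : ℕ → ℕ → ℕ) (i k : ℕ) : G M i k ≤ G M i (k+1) := by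
  cases i with
  | zero => simp [G]
  | succ i => rw [G]; omega

lemma G_le_left (M : ℕ → ℕ → ℕ) (i k : ℕ) : G M i k ≤ G M (i+1) k := by
  cases k with
  | zero => cases i <;> simp [G]
  | succ i => rw [G]; omega

lemma G_right_le (M : ℕ → ℕ → ℕ) (i k : ℕ) : G M i (k+1) ≤ G M i k + 1 := by
  induction i with
  | zero => simp [G]
  | succ i ih =>
    have := G_le_left M i k
    rw [G]; split_ifs <;> omega

lemma G_zero_right (M : ℕ → ℕ → ℕ) (i : ℕ) : G M i 0 = 0 := by cases i <;> simp [G]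

lemma G_tr (M : ℕ → ℕ → ℕ) (i k : ℕ) : G (fun a b => M b a) k i = G M i k := by
  induction i generalizing k with
  | zero => rw [G_zero_right]; simp [G]
  | succ i ih =>
    induction k with
    | zero => rw [G_zero_right]; simp [G]
    | succ k ihk =>
      rw [G, G, ih, ih, ihk, max_comm (G M (i+1) k)]

lemma G_left_le (M : ℕ → ℕ → ℕ) (i k : ℕ) : G M (i+1) k ≤ G M i k + 1 := by
  have := G_right_le (fun a b => M b a) k i
  rwa [G_tr M, G_tr M] at this

lemma nxt_tr (M : ℕ → ℕ → ℕ) (i k : ℕ) : nxt (fun a b => M b a) k i = nxt M i k := by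
  simp only [nxt, G_tr]; omega

lemma nxt_eq (M : ℕ → ℕ → ℕ) (i k : ℕ) :
    nxt M i k + G M i k + G M (i+1) (k+1) = M i k + G M i (k+1) + G M (i+1) k := by
  have h1 := G_le_left M i k
  have h2 := G_le_right M i k
  have h3 := G_left_le M i k
  have h4 := G_right_le M i k
  unfold nxt
  rw [G]
  split_ifs <;> omega

lemma G_nxt_le (M : ℕ → ℕ → ℕ) (i k : ℕ) : G (nxt M) i k ≤ G M i k := by
  induction i generalizing k with
  | zero => simp [G]
  | succ i ih =>
    induction k with
    | zero => simp [G]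
    | succ k ihk =>
      have e := nxt_eq M i k
      have h1 := G_le_left M i k
      have h2 := G_le_right M i k
      have h3 := G_left_le M i (k+1)
      have h4 := G_right_le M (i+1) k
      have h5 := ih k
      have h6 := ih (k+1)
      have h7 : G M (i+1) (k+1) = _ := G.eq_3 M i k
      rw [G.eq_3 (nxt M)]
      split_ifs with hh
      · split_ifs at h7 <;> omega
      · omega

lemma G_inj (n : ℕ) (M X : ℕ → ℕ → ℕ) (h1 : ∀ k ≤ n, G M n k = G X n k)
    (h2 : ∀ i ≤ n, G M i n = G X i n) (h3 : ∀ i < n, ∀ k < n, nxt M i k = nxt X i k) :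
    ∀ i < n, ∀ k < n, M i k = X i k := by
  have key : ∀ p q, p ≤ n → q ≤ n → G M (n - p) (n - q) = G X (n - p) (n - q) := by
    intro p
    induction p with
    | zero => intro q _ _; exact h1 _ (by omega)
    | succ p ihp =>
      intro q
      induction q with
      | zero => intro _ _; exact h2 _ (by omega)
      | succ q ihq =>
        intro hp hq
        have a1 := ihp (q+1) (by omega) hq
        have a2 := ihp q (by omega) (by omega)
        have a3 := ihq hp (by omega)
        obtain ⟨i, hi⟩ : ∃ i, n - (p+1) = i := ⟨_, rfl⟩
        obtain ⟨k, hk⟩ : ∃ i, n - (q+1) = i := ⟨_, rfl⟩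
        rw [show n - p = i + 1 by omega] at a1 a2
        rw [show n - q = k + 1 by omega] at a3 a2
        rw [hk] at a1 ⊢
        rw [hi] at a3 ⊢
        have b := h3 i (by omega) k (by omega)
        have c1 := nxt_eq M i k
        have c2 := nxt_eq X i k
        have d1 := G_le_left M i k
        have d2 := G_le_right M i k
        have d3 := G_left_le M i k
        have d4 := G_right_le M i k
        have e1 := G_le_left X i k
        have e2 := G_le_right X i k
        have e3 := G_left_le X i k
        have e4 := G_right_le X i k
        have f1 : G M (i+1) (k+1) = _ := G.eq_3 M i k
        have f2 : G X (i+1) (k+1) = _ := G.eq_3 X i k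
        split_ifs at f1 f2 <;> omega
  have key' : ∀ i ≤ n, ∀ k ≤ n, G M i k = G X i k := by
    intro i hi k hk
    have := key (n - i) (n - k) (by omega) (by omega)
    rwa [show n - (n - i) = i by omega, show n - (n - k) = k by omega] at this
  intro i hi k hk
  have c1 := nxt_eq M i k
  have c2 := nxt_eq X i k
  rw [h3 i hi k hk, key' i (by omega) k (by omega), key' (i+1) hi (k+1) hk,
    key' i (by omega) (k+1) hk, key' (i+1) hi k (by omega)] at c1
  omega

/-- backward growth -/
def Fr (n : ℕ) (X : ℕ → ℕ → ℕ) (h : ℕ → ℕ) : ℕ → ℕ → ℕ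
  | 0, k => h (n - k)
  | i + 1, 0 => h (n - (i + 1))
  | i + 1, k + 1 => min (min (Fr n X h i (k+1)) (Fr n X h (i+1) k))
      (Fr n X h i k - if 0 < X (n - (i+1)) (n - (k+1)) then 1 else 0)

lemma Fr_zero_right (n : ℕ) (X : ℕ → ℕ → ℕ) (h : ℕ → ℕ) (i : ℕ) :
    Fr n X h i 0 = h (n - i) := by cases i <;> simp [Fr]

lemma Fr_symm (n : ℕ) (X : ℕ → ℕ → ℕ) (h : ℕ → ℕ) (hX : ∀ i k, X i k = X k i) (i k : ℕ) :
    Fr n X h i k = Fr n X h k i := by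
  induction i generalizing k with
  | zero => rw [Fr_zero_right]; simp [Fr]
  | succ i ih =>
    induction k with
    | zero => rw [Fr_zero_right]; simp [Fr]
    | succ k ihk =>
      rw [Fr, Fr, ih, ih, ihk, hX, min_comm (Fr n X h (k+1) i)]

lemma G_surj (n : ℕ) (X : ℕ → ℕ → ℕ) (h : ℕ → ℕ) (hX : ∀ i k, X i k = X k i) (h0 : h 0 = 0)
    (hs : ∀ k, h k ≤ h (k+1) ∧ h (k+1) ≤ h k + 1) (hG : ∀ k ≤ n, G X n k ≤ h k) :
    ∃ M : ℕ → ℕ → ℕ, (∀ i k, M i k = M k i) ∧ (∀ k ≤ n, G M n k = h k) ∧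
      ∀ i < n, ∀ k < n, nxt M i k = X i k := by
  have hsy := Fr_symm n X h hX
  have hXG : ∀ i k, G X i k = G X k i := by
    intro i k
    rw [← G_tr]
    congr 1
    funext a b
    exact hX _ _
  have hle : ∀ i k, Fr n X h (i+1) k ≤ Fr n X h i k := by
    intro i k
    cases k with
    | zero =>
      rw [Fr_zero_right, Fr_zero_right]
      by_cases hi : i < n
      · have := (hs (n - (i+1))).1
        rwa [show n - (i+1) + 1 = n - i by omega] at this
      · rw [show n - (i+1) = n - i by omega]
    | succ k => rw [Fr]; omega
  have hle1 : ∀ i k, Fr n X h i k ≤ Fr n X h (i+1) k + 1 := by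
    intro i k
    induction k with
    | zero =>
      rw [Fr_zero_right, Fr_zero_right]
      by_cases hi : i < n
      · have := (hs (n - (i+1))).2
        rwa [show n - (i+1) + 1 = n - i by omega] at this
      · rw [show n - (i+1) = n - i by omega]; omega
    | succ k ih =>
      have := hle k i
      rw [hsy, hsy k] at this
      rw [Fr]
      split_ifs <;> omega
  have hge : ∀ p q, p ≤ n → q ≤ n → G X (n - p) (n - q) ≤ Fr n X h p q := by
    intro p
    induction p with
    | zero => intro q _ _; rw [Fr]; exact hG _ (by omega)
    | succ p ihp =>
      intro q
      induction q with
      | zero => intro _ _; rw [Fr, hXG]; exact hG _ (by omega)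
      | succ q ihq =>
        intro hp hq
        have a1 := ihp (q+1) (by omega) hq
        have a2 := ihp q (by omega) (by omega)
        have a3 := ihq hp (by omega)
        rw [Fr]
        obtain ⟨i, hi⟩ : ∃ i, n - (p+1) = i := ⟨_, rfl⟩
        obtain ⟨k, hk⟩ : ∃ i, n - (q+1) = i := ⟨_, rfl⟩
        rw [show n - p = i + 1 by omega] at a1 a2
        rw [show n - q = k + 1 by omega] at a3 a2
        rw [hk] at a1 ⊢
        rw [hi] at a3 ⊢
        have d1 := G_le_left X i k
        have d2 := G_le_right X i k
        have f1 : G X (i+1) (k+1) = _ := G.eq_3 X i k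
        split_ifs at f1 ⊢ <;> omega
  set F : ℕ → ℕ → ℕ := fun i k => Fr n X h (n - i) (n - k) with hF
  have hF0 : ∀ i ≤ n, F i 0 = 0 := by
    intro i hi
    have : ∀ p, Fr n X h p n = 0 := by
      intro p
      induction p with
      | zero => simp [Fr, h0]
      | succ p ih => have := hle p n; omega
    simp [hF, this]
  have hFs : ∀ i k, F i k = F k i := fun i k => hsy _ _
  have hF0' : ∀ i ≤ n, F 0 i = 0 := fun i hi => by rw [hFs, hF0 i hi]
  have hrec : ∀ i < n, ∀ k < n, F i k = min (min (F (i+1) k) (F i (k+1)))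
      (F (i+1) (k+1) - if 0 < X i k then 1 else 0) := by
    intro i hi k hk
    obtain ⟨p, hp⟩ : ∃ p, n - i = p + 1 := ⟨n - i - 1, by omega⟩
    obtain ⟨q, hq⟩ : ∃ p, n - k = p + 1 := ⟨n - k - 1, by omega⟩
    simp only [hF]
    rw [hp, hq, show n - (i+1) = p by omega, show n - (k+1) = q by omega, Fr,
      show n - (p+1) = i by omega, show n - (q+1) = k by omega]
  have s1 : ∀ i < n, ∀ k, F i k ≤ F (i+1) k ∧ F (i+1) k ≤ F i k + 1 := by
    intro i hi k
    obtain ⟨p, hp⟩ : ∃ p, n - i = p + 1 := ⟨n - i - 1, by omega⟩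
    simp only [hF]
    rw [hp, show n - (i+1) = p by omega]
    exact ⟨hle _ _, hle1 _ _⟩
  have s2 : ∀ k < n, ∀ i, F i k ≤ F i (k+1) ∧ F i (k+1) ≤ F i k + 1 := by
    intro k hk i
    rw [hFs i k, hFs i (k+1)]; exact s1 k hk i
  have hpos : ∀ i < n, ∀ k < n, 0 < X i k → 0 < F (i+1) (k+1) := by
    intro i hi k hk hx
    have := hge (n - (i+1)) (n - (k+1)) (by omega) (by omega)
    rw [show n - (n - (i+1)) = i+1 by omega, show n - (n - (k+1)) = k+1 by omega] at this
    have f1 : G X (i+1) (k+1) = _ := G.eq_3 X i k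
    rw [if_pos hx] at f1
    simp only [hF]
    omega
  set M : ℕ → ℕ → ℕ := fun i k => X i k + F i k + F (i+1) (k+1) - F i (k+1) - F (i+1) k with hM
  have hMe : ∀ i < n, ∀ k < n, M i k + F i (k+1) + F (i+1) k = X i k + F i k + F (i+1) (k+1) := by
    intro i hi k hk
    have r := hrec i hi k hk
    have a := s1 i hi k
    have b := s2 k hk i
    have c := s1 i hi (k+1)
    have d := s2 k hk (i+1)
    have e := hpos i hi k hk
    simp only [hM]
    split_ifs at r <;> omega
  have hGF : ∀ i ≤ n, ∀ k ≤ n, G M i k = F i k := by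
    intro i
    induction i with
    | zero => intro _ k hk; rw [hF0' k hk]; simp [G]
    | succ i ihi =>
      intro hi k
      induction k with
      | zero => intro _; rw [hF0 _ hi]; simp [G]
      | succ k ihk =>
        intro hk
        rw [G, ihi (by omega) _ hk, ihi (by omega) k (by omega), ihk (by omega)]
        have r := hrec i hi k hk
        have m := hMe i hi k hk
        have a := s1 i hi k
        have b := s2 k hk i
        have c := s1 i hi (k+1)
        have d := s2 k hk (i+1)
        have e := hpos i hi k hk
        split_ifs at r ⊢ <;> omega
  refine ⟨M, ?_, ?_, ?_⟩
  · intro i k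
    simp only [hM]
    rw [hX i k, hFs i k, hFs (i+1) (k+1), hFs i (k+1), hFs (i+1) k]
    omega
  · intro k hk
    rw [hGF n le_rfl k hk]
    simp only [hF]
    rw [Nat.sub_self, Fr, show n - (n - k) = k by omega]
  · intro i hi k hk
    have e := nxt_eq M i k
    have m := hMe i hi k hk
    rw [hGF i (by omega) k (by omega), hGF i (by omega) (k+1) hk, hGF (i+1) hi k (by omega),
      hGF (i+1) hi (k+1) hk] at e
    omega

end RSK
namespace RSK

lemma count_add_cnt (v : ℕ) (c : List ℕ) : c.count v + cnt (v+1) c = cnt v c := by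
  induction c with
  | nil => simp
  | cons x c ih =>
    rw [cnt_cons, cnt_cons, List.count_cons, ← ih]
    simp only [beq_iff_eq]
    split_ifs <;> omega

lemma sorted_ext (c d : List ℕ) (hc : c.Pairwise (· < ·)) (hd : d.Pairwise (· < ·))
    (h : ∀ b, cnt b c = cnt b d) : c = d := by
  have hp : c.Perm d := by
    rw [List.perm_iff_count]
    intro v
    have h1 := count_add_cnt v c
    have h2 := count_add_cnt v d
    rw [h, h] at h1
    omega
  exact hp.eq_of_pairwise (fun a b _ _ h1 h2 => absurd h1 (by omega)) hc hd

lemma cnt_zero_of_ge (n : ℕ) (M : ℕ → ℕ → ℕ) (i b : ℕ) (hb : n ≤ b) :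
    cnt b (cf [] (Wd n M i)).1 = 0 := by
  rw [cnt_cf, H_Wd_of_ge _ _ _ _ hb]

lemma cnt_G (n : ℕ) (M : ℕ → ℕ → ℕ) (i k : ℕ) (hk : k ≤ n) :
    cnt (n - k) (cf [] (Wd n M i)).1 = G M i k := by
  rw [cnt_cf, H_Wd _ _ _ _ hk]

lemma cf_Wd (n : ℕ) (M : ℕ → ℕ → ℕ) (i : ℕ) :
    (cf [] (Wd n M i)).2 = Wd n (nxt M) i := by
  induction i with
  | zero => rfl
  | succ i ih =>
    have hC' : (cf [] (Wd n M (i+1))).1 = (cf (cf [] (Wd n M i)).1 (row n M i)).1 := by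
      rw [Wd, cf_append]
    have hperm := cf_perm (cf [] (Wd n M i)).1 (row n M i)
    rw [← hC'] at hperm
    have hs := (cf_row_sorted _ _ (cf_sorted (Wd n M i)) (row_sorted n M i)).1
    have key : (cf (cf [] (Wd n M i)).1 (row n M i)).2 = row n (nxt M) i := by
      have hp : (cf (cf [] (Wd n M i)).1 (row n M i)).2.Perm (row n (nxt M) i) := by
        rw [List.perm_iff_count]
        intro v
        have e := hperm.count_eq v
        rw [List.count_append, List.count_append] at e
        have c1 := count_add_cnt v (cf [] (Wd n M i)).1
        have c2 := count_add_cnt v (cf [] (Wd n M (i+1))).1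
        by_cases hv : v < n
        · obtain ⟨k, hk, rfl⟩ : ∃ k < n, v = n - 1 - k := ⟨n - 1 - v, by omega, by omega⟩
          rw [count_row _ _ _ _ hk] at e ⊢
          rw [show n - 1 - k + 1 = n - k by omega, cnt_G _ _ _ _ (by omega),
            show cnt (n - 1 - k) = cnt (n - (k+1)) by congr 1; omega,
            cnt_G _ _ _ _ (by omega)] at c1 c2
          have := nxt_eq M i k
          omega
        · rw [cnt_zero_of_ge _ _ _ _ (by omega), cnt_zero_of_ge _ _ _ _ (by omega)] at c1 c2
          have hz : ∀ M, (row n M i).count v = 0 := by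
            intro M
            rw [List.count_eq_zero, mem_row]
            rintro ⟨k, hk, -, rfl⟩
            omega
          rw [hz] at e ⊢
          omega
      exact hp.eq_of_pairwise (fun a b _ _ h1 h2 => le_antisymm h2 h1) hs (row_sorted _ _ _)
    rw [Wd, cf_append, Wd, ← ih, key]

/-- first column -/
def colM (n : ℕ) (M : ℕ → ℕ → ℕ) : List ℕ := (cf [] (Wd n M n)).1

lemma PW_Wd (n : ℕ) (M : ℕ → ℕ → ℕ) (h : Wd n M n ≠ []) :
    PW (Wd n M n) = colM n M :: PW (Wd n (nxt M) n) := by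
  rw [PW_eq _ h, cf_Wd]; rfl

lemma cnt_colM (n : ℕ) (M : ℕ → ℕ → ℕ) (b : ℕ) : cnt b (colM n M) = G M n (n - b) := by
  by_cases hb : b ≤ n
  · have := cnt_G n M n (n - b) (by omega)
    rwa [show n - (n - b) = b by omega] at this
  · rw [show n - b = 0 by omega, G_zero_right]
    exact cnt_zero_of_ge _ _ _ _ (by omega)

lemma Wd_length (n : ℕ) (M : ℕ → ℕ → ℕ) (h : Wd n M n ≠ []) :
    (Wd n (nxt M) n).length < (Wd n M n).length := by
  have := (cf_perm [] (Wd n M n)).length_eq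
  rw [cf_Wd] at this
  simp only [List.length_append, List.length_nil] at this
  obtain ⟨x, w, hw⟩ := List.exists_cons_of_ne_nil h
  have h2 := cf_ne_nil x w
  rw [← hw] at h2
  have := List.length_pos_iff.2 h2
  omega

lemma Wd_eq_nil_iff (n : ℕ) (M : ℕ → ℕ → ℕ) :
    Wd n M n = [] ↔ ∀ i < n, ∀ k < n, M i k = 0 := by
  have : ∀ I, Wd n M I = [] ↔ ∀ i < I, ∀ k < n, M i k = 0 := by
    intro I
    induction I with
    | zero => simp [Wd]
    | succ I ih =>
      have hr : row n M I = [] ↔ ∀ k < n, M I k = 0 := by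
        simp [row, List.flatMap_eq_nil_iff]
      rw [Wd, List.append_eq_nil_iff, ih, hr]
      constructor
      · rintro ⟨h1, h2⟩ i hi
        rcases Nat.lt_succ_iff_lt_or_eq.1 hi with h | rfl
        · exact h2 i h
        · exact h1
      · intro h
        exact ⟨h I (by omega), fun i hi => h i (by omega)⟩
  exact this n

lemma Wd_congr (n : ℕ) (M X : ℕ → ℕ → ℕ) (h : ∀ i < n, ∀ k < n, M i k = X i k) :
    Wd n M n = Wd n X n := by
  have : ∀ I ≤ n, Wd n M I = Wd n X I := by
    intro I
    induction I with
    | zero => intro _; rfl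
    | succ I ih =>
      intro hI
      rw [Wd, Wd, ih (by omega)]
      congr 1
      unfold row
      apply List.flatMap_congr
      intro k hk
      rw [h I (by omega) k (by simpa using hk)]
  exact this n le_rfl

lemma PW_inj (n : ℕ) (M X : ℕ → ℕ → ℕ) (h1 : PW (Wd n M n) = PW (Wd n X n))
    (h2 : PW (Wd n (fun a b => M b a) n) = PW (Wd n (fun a b => X b a) n)) :
    ∀ i < n, ∀ k < n, M i k = X i k := by
  induction hL : (Wd n M n).length using Nat.strong_induction_on generalizing M X with
  | _ L ih =>
    by_cases h0 : Wd n M n = []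
    · rw [(PW_eq_nil _).2 h0, eq_comm, PW_eq_nil, Wd_eq_nil_iff] at h1
      rw [Wd_eq_nil_iff] at h0
      intro i hi k hk
      rw [h0 i hi k hk, h1 i hi k hk]
    · have hX0 : Wd n X n ≠ [] := by rwa [Ne, ← PW_eq_nil, ← h1, PW_eq_nil]
      have htr : ∀ Y : ℕ → ℕ → ℕ, Wd n Y n ≠ [] → Wd n (fun a b => Y b a) n ≠ [] := by
        intro Y hY h
        apply hY
        rw [Wd_eq_nil_iff] at h ⊢
        exact fun i hi k hk => h k hk i hi
      rw [PW_Wd _ _ h0, PW_Wd _ _ hX0, List.cons.injEq] at h1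
      rw [PW_Wd _ _ (htr _ h0), PW_Wd _ _ (htr _ hX0), List.cons.injEq] at h2
      have hn : ∀ Y : ℕ → ℕ → ℕ, nxt (fun a b => Y b a) = fun a b => nxt Y b a := by
        intro Y; funext a b; exact nxt_tr Y b a
      rw [hn M, hn X] at h2
      have h3 := ih _ (hL ▸ Wd_length n M h0) (nxt M) (nxt X) h1.2 h2.2 rfl
      apply G_inj n M X _ _ h3
      · intro k hk
        have := cnt_colM n M (n - k)
        rwa [h1.1, cnt_colM, show n - (n - k) = k by omega, eq_comm] at this
      · intro k hk
        have := cnt_colM n (fun a b => M b a) (n - k)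
        rwa [h2.1, cnt_colM, show n - (n - k) = k by omega, eq_comm, G_tr M, G_tr X] at this

lemma getElem_le_cnt (c : List ℕ) (hc : c.Pairwise (· < ·)) (b r : ℕ) (h1 : 1 ≤ r)
    (h2 : r ≤ c.length) : b ≤ c.getD (c.length - r) 0 ↔ r ≤ cnt b c := by
  induction c with
  | nil => simp at h2; omega
  | cons a l ih =>
    rw [List.pairwise_cons] at hc
    rw [cnt_cons]
    have hlen : cnt b l ≤ l.length := List.countP_le_length
    simp only [List.length_cons] at h2 ⊢
    by_cases hr : r ≤ l.length
    · rw [show l.length + 1 - r = (l.length - r) + 1 by omega, List.getD_cons_succ,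
        ih hc.2 hr]
      split_ifs with hb
      · rw [cnt_all b l (fun z hz => by have := hc.1 z hz; omega)]; omega
      · simp
    · rw [show l.length + 1 - r = 0 by omega, List.getD_cons_zero]
      split_ifs with hb
      · rw [cnt_all b l (fun z hz => by have := hc.1 z hz; omega)]; omega
      · omega

lemma compat_iff (c d : List ℕ) (hc : c.Pairwise (· < ·)) (hd : d.Pairwise (· < ·)) :
    (∀ b, cnt b d ≤ cnt b c) ↔ d.length ≤ c.length ∧ ∀ ρ x y,
      (if 1 ≤ ρ ∧ ρ ≤ d.length then d[d.length - ρ]? else none) = some x →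
      (if 1 ≤ ρ ∧ ρ ≤ c.length then (c)[c.length - ρ]? else none) = some y → x ≤ y := by
  have hl : ∀ e : List ℕ, cnt 0 e = e.length := fun e => cnt_all 0 e (by simp)
  have hget : ∀ (e : List ℕ) ρ x, (if 1 ≤ ρ ∧ ρ ≤ e.length then e[e.length - ρ]? else none) = some x
      ↔ 1 ≤ ρ ∧ ρ ≤ e.length ∧ e.getD (e.length - ρ) 0 = x := by
    intro e ρ x
    split_ifs with h
    · have : e.length - ρ < e.length := by omega
      simp [h.1, h.2, this, List.getElem?_eq_getElem]
    · simp; tauto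
  constructor
  · intro h
    refine ⟨by simpa [hl] using h 0, ?_⟩
    intro ρ x y hx hy
    rw [hget] at hx hy
    obtain ⟨h1, h2, rfl⟩ := hx
    obtain ⟨_, h3, rfl⟩ := hy
    rw [getElem_le_cnt c hc _ _ h1 h3]
    exact le_trans ((getElem_le_cnt d hd _ _ h1 h2).1 le_rfl) (h _)
  · rintro ⟨h1, h2⟩ b
    by_cases h0 : cnt b d = 0
    · omega
    · have hle : cnt b d ≤ d.length := List.countP_le_length
      have h3 := h2 (cnt b d) _ _ ((hget _ _ _).2 ⟨by omega, hle, rfl⟩)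
        ((hget _ _ _).2 ⟨by omega, by omega, rfl⟩)
      rw [← getElem_le_cnt c hc _ _ (by omega) (by omega)]
      exact le_trans ((getElem_le_cnt d hd _ _ (by omega) hle).2 le_rfl) h3

lemma IsRotSST_nil (n : ℕ) : IsRotSST n [] := by
  simp [IsRotSST, List.Chain']

lemma IsRotSST_cons (n : ℕ) (c : List ℕ) (t : List (List ℕ)) :
    IsRotSST n (c :: t) ↔ (c ≠ [] ∧ c.Pairwise (· < ·) ∧ ∀ x ∈ c, x < n) ∧
      (∀ b, cnt b (t.headD []) ≤ cnt b c) ∧ IsRotSST n t := by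
  have hch : ∀ e : List ℕ, e.Chain' (· < ·) ↔ e.Pairwise (· < ·) :=
    fun e => List.isChain_iff_pairwise
  have hlen : ((c :: t).map List.length).Chain' (· ≥ ·) ↔
      (t.headD []).length ≤ c.length ∧ (t.map List.length).Chain' (· ≥ ·) := by
    cases t with
    | nil => simp [List.Chain']
    | cons d t => simp [List.Chain', List.isChain_cons_cons]
  have h0 : t.getD 0 [] = t.headD [] := by cases t <;> simp
  have hd : IsRotSST n t → (t.headD []).Pairwise (· < ·) := by
    intro h
    cases t with
    | nil => simp
    | cons d t => exact (hch _).1 (h.1 d (by simp)).2.1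
  constructor
  · rintro ⟨a1, a2, a3⟩
    have ht : IsRotSST n t := by
      refine ⟨fun e he => a1 e (by simp [he]), (hlen.1 a2).2, fun j => ?_⟩
      simpa using a3 (j+1)
    have hc := a1 c (by simp)
    rw [hch] at hc
    refine ⟨hc, ?_, ht⟩
    rw [compat_iff _ _ hc.2.1 (hd ht)]
    refine ⟨(hlen.1 a2).1, ?_⟩
    have := a3 0
    rw [List.getD_cons_succ, h0, List.getD_cons_zero] at this
    exact this
  · rintro ⟨hc, b, ht⟩
    rw [compat_iff _ _ hc.2.1 (hd ht)] at b
    rw [← hch] at hc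
    refine ⟨?_, hlen.2 ⟨b.1, ht.2.1⟩, fun j => ?_⟩
    · intro e he
      rcases List.mem_cons.1 he with rfl | he
      · exact hc
      · exact ht.1 e he
    · cases j with
      | zero =>
        rw [List.getD_cons_succ, h0, List.getD_cons_zero]
        exact b.2
      | succ j =>
        rw [List.getD_cons_succ, List.getD_cons_succ]
        exact ht.2.2 j

lemma cnt_head (n : ℕ) (M : ℕ → ℕ → ℕ) (b : ℕ) :
    cnt b ((PW (Wd n M n)).headD []) = G M n (n - b) := by
  rw [← cnt_colM]
  by_cases h : Wd n M n = []
  · rw [(PW_eq_nil _).2 h, colM, h]; simp [cf]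
  · rw [PW_Wd _ _ h]; rfl

lemma PW_valid (n : ℕ) (M : ℕ → ℕ → ℕ) : IsRotSST n (PW (Wd n M n)) := by
  induction hL : (Wd n M n).length using Nat.strong_induction_on generalizing M with
  | _ L ih =>
    by_cases h0 : Wd n M n = []
    · rw [(PW_eq_nil _).2 h0]; exact IsRotSST_nil n
    · rw [PW_Wd _ _ h0, IsRotSST_cons]
      refine ⟨⟨?_, cf_sorted _, ?_⟩, ?_, ih _ (hL ▸ Wd_length n M h0) _ rfl⟩
      · obtain ⟨x, w, hw⟩ := List.exists_cons_of_ne_nil h0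
        rw [colM, hw]; exact cf_ne_nil x w
      · intro x hx
        by_contra hxn
        have := cnt_zero_of_ge n M n x (by omega)
        rw [cnt, List.countP_eq_zero] at this
        exact this x hx (by simp)
      · intro b
        rw [cnt_head, cnt_colM]
        exact G_nxt_le _ _ _

lemma PW_surj (n : ℕ) (t : List (List ℕ)) (ht : IsRotSST n t) :
    ∃ M : ℕ → ℕ → ℕ, (∀ i k, M i k = M k i) ∧ PW (Wd n M n) = t := by
  induction t with
  | nil =>
    refine ⟨fun _ _ => 0, fun _ _ => rfl, ?_⟩
    rw [PW_eq_nil, Wd_eq_nil_iff]; simp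
  | cons c t ih =>
    rw [IsRotSST_cons] at ht
    obtain ⟨⟨hc0, hcs, hcn⟩, hcomp, ht⟩ := ht
    obtain ⟨X, hX, rfl⟩ := ih ht
    obtain ⟨M, hM, hMG, hMX⟩ := G_surj n X
      (fun k => if k ≤ n then cnt (n - k) c else cnt 0 c) hX
      (by simpa using cnt_none n c hcn)
      (by
        intro k
        by_cases hk : k + 1 ≤ n
        · have := count_add_cnt (n - (k+1)) c
          rw [show n - (k+1) + 1 = n - k by omega] at this
          have h2 : c.count (n - (k+1)) ≤ 1 :=
            List.nodup_iff_count_le_one.1 (hcs.imp (fun h => Nat.ne_of_lt h)) _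
          simp only [hk, if_true, show k ≤ n by omega]
          omega
        · by_cases hk2 : k = n
          · subst hk2; simp
          · simp [hk, show ¬ k ≤ n by omega])
      (by
        intro k hk
        simp only [hk, if_true]
        have := hcomp (n - k)
        rwa [cnt_head, show n - (n - k) = k by omega] at this)
    have hcol : colM n M = c := by
      apply sorted_ext _ _ (cf_sorted _) hcs
      intro b
      change cnt b (colM n M) = _
      rw [cnt_colM, hMG _ (by omega), if_pos (by omega)]
      by_cases hb : b ≤ n
      · rw [show n - (n - b) = b by omega]
      · rw [show n - (n - b) = n by omega, cnt_none n c hcn,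
          cnt_none b c (fun z hz => by have := hcn z hz; omega)]
    refine ⟨M, hM, ?_⟩
    rw [PW_Wd, hcol, Wd_congr n _ _ hMX]
    intro h
    rw [colM, h] at hcol
    exact hc0 hcol.symm

/-- extension of a finite matrix, with reversed indices. -/
def ext (n : ℕ) (m : Fin n → Fin n → ℕ) (i k : ℕ) : ℕ :=
  if h : i < n ∧ k < n then m (Fin.rev ⟨i, h.1⟩) (Fin.rev ⟨k, h.2⟩) else 0

lemma rowWordOf_eq (n : ℕ) (m : Fin n → Fin n → ℕ) (a : Fin n) :
    rowWordOf n m a.rev = row n (ext n m) a := by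
  unfold rowWordOf row
  rw [List.finRange_reverse, ← List.map_coe_finRange_eq_range, List.flatMap_map, List.flatMap_map]
  apply List.flatMap_congr
  intro b _
  simp only [ext, a.2, b.2, and_self, dite_true, Fin.eta]
  congr 1
  simp [Fin.val_rev]; omega

lemma Pm_eq (n : ℕ) (m : Fin n → Fin n → ℕ) : Pm n m = PW (Wd n (ext n m) n) := by
  unfold Pm PW
  congr 1
  unfold wordOf
  have h1 : (List.finRange n) = ((List.finRange n).reverse).map Fin.rev := by
    rw [List.finRange_reverse, List.map_map]
    simp [Function.comp_def]
  have h2 : ∀ I, ((List.range I).reverse).flatMap (row n (ext n m)) = Wd n (ext n m) I := by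
    intro I
    induction I with
    | zero => rfl
    | succ I ih => simp [List.range_succ, Wd, ih]
  rw [h1, List.flatMap_map, ← h2, ← List.map_coe_finRange_eq_range, ← List.map_reverse,
    List.flatMap_map]
  apply List.flatMap_congr
  intro a _
  exact rowWordOf_eq n m a

lemma ext_tr (n : ℕ) (m : Fin n → Fin n → ℕ) :
    ext n (fun a b => m b a) = fun i k => ext n m k i := by
  funext i k
  by_cases hi : i < n <;> by_cases hk : k < n <;> simp [ext, hi, hk]

lemma ext_inj (n : ℕ) (m x : Fin n → Fin n → ℕ)
    (h : ∀ i < n, ∀ k < n, ext n m i k = ext n x i k) : m = x := by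
  funext a b
  have := h a.rev a.rev.2 b.rev b.rev.2
  simp only [ext, a.rev.2, b.rev.2, and_self, dite_true, Fin.eta, Fin.rev_rev] at this
  exact this

lemma Pm_inj (n : ℕ) (m x : Fin n → Fin n → ℕ) (h1 : Pm n m = Pm n x)
    (h2 : Pm n (fun a b => m b a) = Pm n (fun a b => x b a)) : m = x := by
  rw [Pm_eq, Pm_eq] at h1 h2
  rw [ext_tr n m, ext_tr n x] at h2
  exact ext_inj n m x (PW_inj n _ _ h1 h2)

end RSK

open RSK

/-- RSK symmetry for reverse column insertion: `P(m) = P(mᵗ)` iff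
`m = mᵗ`, and `P` restricts to a bijection from symmetric matrices onto
`⊔_μ SST_{[n̄]}(μ^π)`. -/
theorem RSK_symmetry (n : ℕ) :
    (∀ m : Fin n → Fin n → ℕ,
        Pm n m = Pm n (fun a b => m b a) ↔ ∀ a b, m a b = m b a) ∧
    Set.BijOn (Pm n) {m | ∀ a b, m a b = m b a} {t | IsRotSST n t} := by
  have hsym : ∀ m : Fin n → Fin n → ℕ, (∀ a b, m a b = m b a) → (fun a b => m b a) = m := by
    intro m h
    funext a b
    exact h b a
  refine ⟨fun m => ⟨fun h a b => ?_, fun h => by rw [hsym m h]⟩, ?_, ?_, ?_⟩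
  · exact congrFun (congrFun (Pm_inj n m (fun a b => m b a) h h.symm) a) b
  · intro m _
    show IsRotSST n (Pm n m)
    rw [Pm_eq]
    exact PW_valid _ _
  · intro m hm x hx h
    apply Pm_inj n m x h
    rw [hsym m hm, hsym x hx]
    exact h
  · intro t ht
    obtain ⟨M, hM, rfl⟩ := PW_surj n t ht
    refine ⟨fun a b => M a.rev b.rev, fun a b => hM _ _, ?_⟩
    rw [Pm_eq]
    congr 1
    apply Wd_congr
    intro i hi k hk
    simp [ext, hi, hk]
end
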